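/- arXiv:2011.10552 — 5 statements merged into one kernel-verified Lean document; each statement's English description precedes it below -/
import Mathlib

section
/- Let k be a positive even integer and let q be a complex number with ‖q‖ < 1. Then (q;q)_∞³ = Σ_{ℓ=0}^{k/2−1} (−1)^ℓ q^{ℓ(ℓ+1)/2} · (−q^{k(k−1−2ℓ)/2}, −q^{k(k+1+2ℓ)/2}, q^{k²}; q^{k²})_∞ · ( 2ℓ+1 − 2k·Σ_{n≥0} [ q^{k(kn+(k−1−2ℓ)/2)}/(1 + q^{k(kn+(k−1−2ℓ)/2)}) − q^{k(kn+(k+1+2ℓ)/2)}/(1 + q^{k(kn+(k+1+2ℓ)/2)}) ] ). (Since k is even, all exponents occurring are nonnegative integers, and all infinite products and series converge absolutely.) -/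
/-- `(a;q)_∞ = ∏_{j ≥ 0} (1 - a q^j)`. -/
noncomputable def qPochhammerInf (a q : ℂ) : ℂ := ∏' j : ℕ, (1 - a * q ^ j)

namespace CubeEta
open Filter Topology Finset

noncomputable def a (Q : ℂ) (n : ℕ) : ℂ := ∏ j ∈ range n, (1 - Q * Q ^ j)

noncomputable def b (Q : ℂ) (n k : ℕ) : ℂ := if k ≤ n then a Q n / (a Q k * a Q (n - k)) else 0

def T (m : ℤ) : ℤ := m * (m - 1) / 2

lemma two_T (m : ℤ) : 2 * T m = m * (m - 1) := by
  unfold T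
  have : Even (m * (m - 1)) := Int.even_mul_pred_self m
  obtain ⟨r, hr⟩ := this
  omega

lemma two_choose (n : ℕ) : 2 * ((n.choose 2 : ℕ) : ℤ) = n * (n - 1) := by
  induction n with
  | zero => simp
  | succ n ih =>
    have : (n + 1).choose 2 = n + n.choose 2 := by
      simp [Nat.choose_succ_succ]
    rw [this]; push_cast; linarith

lemma one_sub_ne {z : ℂ} (h : ‖z‖ < 1) : 1 - z ≠ 0 := by
  intro h0
  have : z = 1 := by linear_combination -h0
  rw [this] at h; simp at h

lemma norm_mul_pow_lt {z Q : ℂ} (h : ‖z‖ < 1) (hQ : ‖Q‖ < 1) (j : ℕ) : ‖z * Q ^ j‖ < 1 := by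
  rw [norm_mul, norm_pow]
  calc ‖z‖ * ‖Q‖ ^ j ≤ ‖z‖ * 1 := by
        gcongr
        exact pow_le_one₀ (norm_nonneg _) hQ.le
    _ < 1 := by simpa using h

lemma a_ne {Q : ℂ} (hQ : ‖Q‖ < 1) (n : ℕ) : a Q n ≠ 0 := by
  unfold a
  exact prod_ne_zero_iff.mpr fun j _ => one_sub_ne (norm_mul_pow_lt hQ hQ j)

lemma a_succ (Q : ℂ) (n : ℕ) : a Q (n + 1) = a Q n * (1 - Q ^ (n + 1)) := by
  unfold a
  rw [prod_range_succ, pow_succ']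

lemma b_zero {Q : ℂ} (hQ : ‖Q‖ < 1) (n : ℕ) : b Q n 0 = 1 := by
  have := a_ne hQ n
  simp only [b, Nat.zero_le, if_true, Nat.sub_zero]
  have h0 : a Q 0 = 1 := by simp [a]
  rw [h0, one_mul, div_self this]

lemma b_succ {Q : ℂ} (hQ : ‖Q‖ < 1) (n k : ℕ) (hk : k ≤ n) :
    b Q (n + 1) (k + 1) = b Q n (k + 1) + Q ^ (n - k) * b Q n k := by
  obtain ⟨r, rfl⟩ := Nat.exists_eq_add_of_le hk
  have h0 : a Q 0 = 1 := by simp [a]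
  have hne := a_ne hQ
  have h1 : k + r + 1 - (k + 1) = r := by omega
  have h2 : k + r - k = r := by omega
  simp only [b, h1, h2, hk, if_true, show k + 1 ≤ k + r + 1 by omega]
  have hk' : (1 : ℂ) - Q ^ (k + 1) ≠ 0 := by
    have := one_sub_ne (norm_mul_pow_lt hQ hQ k); rwa [← pow_succ'] at this
  rcases r with _ | r
  · simp only [add_zero, h0, show ¬ (k + 1 ≤ k) by omega, if_false]
    have := hne k
    have := hne (k + 1)
    field_simp
    simp
  · have hr' : (1 : ℂ) - Q ^ (r + 1) ≠ 0 := by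
      have := one_sub_ne (norm_mul_pow_lt hQ hQ r); rwa [← pow_succ'] at this
    simp only [show k + 1 ≤ k + (r + 1) by omega, if_true, show k + (r + 1) - (k + 1) = r by omega]
    rw [a_succ Q (k + (r + 1)), a_succ Q k, a_succ Q r]
    have := hne k
    have := hne r
    have := hne (k + (r + 1))
    field_simp
    ring

lemma qbinom {Q : ℂ} (hQ : ‖Q‖ < 1) (y : ℂ) (n : ℕ) :
    ∏ j ∈ range n, (1 + y * Q ^ j) = ∑ k ∈ range (n + 1), b Q n k * (Q ^ (k.choose 2) * y ^ k) := by
  induction n with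
  | zero => simp [b_zero hQ]
  | succ n ih =>
    rw [prod_range_succ, ih, sum_range_succ' _ (n + 1)]
    have e1 : ∀ k ∈ range (n + 1), b Q (n + 1) (k + 1) * (Q ^ ((k + 1).choose 2) * y ^ (k + 1))
        = b Q n (k + 1) * (Q ^ ((k + 1).choose 2) * y ^ (k + 1))
          + (b Q n k * (Q ^ (k.choose 2) * y ^ k)) * (y * Q ^ n) := by
      intro k hk
      have hk' : k ≤ n := by simpa [Nat.lt_succ_iff] using hk
      have h2 : (k + 1).choose 2 = k + k.choose 2 := by simp [Nat.choose_succ_succ]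
      have h3 : Q ^ n = Q ^ (n - k) * Q ^ k := by rw [← pow_add]; congr 1; omega
      rw [b_succ hQ n k hk', h2, h3]
      ring
    rw [sum_congr rfl e1, sum_add_distrib, ← sum_mul]
    have e2 := sum_range_succ' (fun k => b Q n k * (Q ^ (k.choose 2) * y ^ k)) (n + 1)
    rw [sum_range_succ] at e2
    have e3 : b Q n (n + 1) = 0 := by simp [b]
    rw [e3] at e2
    rw [b_zero hQ] at *
    linear_combination e2

lemma prod_aux (Q x : ℂ) (N : ℕ) :
    ∏ i ∈ range N, (x * (Q ^ (i + 1))⁻¹) = x ^ N * (Q ^ ((N + 1).choose 2))⁻¹ := by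
  induction N with
  | zero => simp
  | succ n ih =>
    have h2 : (n + 1 + 1).choose 2 = (n + 1) + (n + 1).choose 2 := by
      simp [Nat.choose_succ_succ]; ring
    rw [prod_range_succ, ih, h2, pow_add Q (n+1), mul_inv, pow_succ x n]
    ring

lemma finite_jtp {Q : ℂ} (hQ : ‖Q‖ < 1) (hQ0 : Q ≠ 0) {x : ℂ} (hx : x ≠ 0) (N : ℕ) :
    (∏ i ∈ range N, (1 + x⁻¹ * Q ^ (i + 1))) * ∏ i ∈ range N, (1 + x * Q ^ i)
      = ∑ k ∈ range (2 * N + 1), b Q (2 * N) k *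
          (Q ^ T ((k : ℤ) - N) * x ^ ((k : ℤ) - N)) := by
  have key := qbinom hQ (x * (Q ^ N)⁻¹) (2 * N)
  rw [two_mul, prod_range_add, ← two_mul] at key
  have hQN : Q ^ N ≠ 0 := pow_ne_zero _ hQ0
  have f2 : ∀ i ∈ range N, 1 + x * (Q ^ N)⁻¹ * Q ^ (N + i) = 1 + x * Q ^ i := by
    intro i _
    rw [pow_add]; field_simp
  rw [prod_congr rfl f2, ← prod_range_reflect] at key
  have f1 : ∀ i ∈ range N, 1 + x * (Q ^ N)⁻¹ * Q ^ (N - 1 - i)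
      = (x * (Q ^ (i + 1))⁻¹) * (1 + x⁻¹ * Q ^ (i + 1)) := by
    intro i hi
    have hi' : i < N := by simpa using hi
    have : Q ^ N = Q ^ (N - 1 - i) * Q ^ (i + 1) := by rw [← pow_add]; congr 1; omega
    rw [this]
    have h1 : Q ^ (N - 1 - i) ≠ 0 := pow_ne_zero _ hQ0
    have h2 : Q ^ (i + 1) ≠ 0 := pow_ne_zero _ hQ0
    field_simp
    ring
  rw [prod_congr rfl f1, prod_mul_distrib, prod_aux] at key
  have hc : x ^ N * (Q ^ ((N + 1).choose 2))⁻¹ ≠ 0 :=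
    mul_ne_zero (pow_ne_zero _ hx) (inv_ne_zero (pow_ne_zero _ hQ0))
  apply mul_left_cancel₀ hc
  rw [← mul_assoc, key, mul_sum]
  apply sum_congr rfl
  intro k _
  have h1 : x ^ k = x ^ N * x ^ ((k : ℤ) - N) := by
    rw [← zpow_natCast, ← zpow_natCast, ← zpow_add₀ hx]; congr 1; ring
  have h2 : Q ^ (k.choose 2) * ((Q ^ N)⁻¹) ^ k
      = (Q ^ ((N + 1).choose 2))⁻¹ * Q ^ T ((k : ℤ) - N) := by
    rw [inv_pow, ← pow_mul, ← zpow_natCast, ← zpow_natCast, ← zpow_natCast, ← zpow_neg, ← zpow_neg,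
      ← zpow_add₀ hQ0, ← zpow_add₀ hQ0]
    congr 1
    have t1 := two_T ((k : ℤ) - N)
    have t2 := two_choose k
    have t3 := two_choose (N + 1)
    push_cast at *
    linarith
  rw [mul_pow, h1]
  linear_combination b Q (2 * N) k * x ^ N * x ^ ((k : ℤ) - N) * h2

noncomputable def G (Q : ℂ) (N : ℕ) (x : ℂ) : ℂ :=
  (∏ i ∈ range N, (1 + x⁻¹ * Q ^ (i + 1))) * ∏ i ∈ range N, (1 + x * Q ^ i)

lemma finite_deriv {Q : ℂ} (hQ : ‖Q‖ < 1) (hQ0 : Q ≠ 0) {x : ℂ} (hx : x ≠ 0) (N : ℕ) :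
    x * deriv (G Q N) x
      = ∑ k ∈ range (2 * N + 1), b Q (2 * N) k *
          ((((k : ℤ) - N : ℤ) : ℂ) * (Q ^ T ((k : ℤ) - N) * x ^ ((k : ℤ) - N))) := by
  have h1 : G Q N =ᶠ[𝓝 x] fun x => ∑ k ∈ range (2 * N + 1), b Q (2 * N) k *
          (Q ^ T ((k : ℤ) - N) * x ^ ((k : ℤ) - N)) := by
    filter_upwards [isOpen_ne.mem_nhds hx] with y hy
    exact finite_jtp hQ hQ0 hy N
  rw [h1.deriv_eq]
  have h2 : HasDerivAt (fun x => ∑ k ∈ range (2 * N + 1), b Q (2 * N) k *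
          (Q ^ T ((k : ℤ) - N) * x ^ ((k : ℤ) - N)))
      (∑ k ∈ range (2 * N + 1), b Q (2 * N) k *
          (Q ^ T ((k : ℤ) - N) * ((((k : ℤ) - N : ℤ) : ℂ) * x ^ ((k : ℤ) - N - 1)))) x := by
    apply HasDerivAt.fun_sum
    intro k _
    exact ((hasDerivAt_zpow _ _ (Or.inl hx)).const_mul _).const_mul _
  rw [h2.deriv, mul_sum]
  apply sum_congr rfl
  intro k _
  rw [zpow_sub_one₀ hx]
  field_simp

lemma G_deriv {Q : ℂ} {x : ℂ} (hx : x ≠ 0) (N : ℕ)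
    (h1 : ∀ i, 1 + x⁻¹ * Q ^ (i + 1) ≠ 0) (h2 : ∀ i, 1 + x * Q ^ i ≠ 0) :
    x * deriv (G Q N) x = G Q N x * ∑ i ∈ range N,
      (x * Q ^ i / (1 + x * Q ^ i) - x⁻¹ * Q ^ (i + 1) / (1 + x⁻¹ * Q ^ (i + 1))) := by
  induction N with
  | zero =>
    have : G Q 0 = fun _ => 1 := by ext; simp [G]
    rw [this]; simp
  | succ N ih =>
    have e : G Q (N + 1) = fun x => G Q N x * ((1 + x⁻¹ * Q ^ (N + 1)) * (1 + x * Q ^ N)) := by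
      ext y; simp only [G, prod_range_succ]; ring
    have d1 : DifferentiableAt ℂ (G Q N) x := by
      unfold G
      apply DifferentiableAt.mul
      · apply DifferentiableAt.fun_finsetProd
        intro i _
        exact ((differentiableAt_inv hx).mul_const _).const_add _
      · apply DifferentiableAt.fun_finsetProd
        intro i _
        fun_prop
    have d2 : HasDerivAt (fun x : ℂ => 1 + x⁻¹ * Q ^ (N + 1)) (-(x ^ 2)⁻¹ * Q ^ (N + 1)) x :=
      ((hasDerivAt_inv hx).mul_const _).const_add _
    have d3 : HasDerivAt (fun x : ℂ => 1 + x * Q ^ N) (1 * Q ^ N) x :=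
      ((hasDerivAt_id x).mul_const _).const_add _
    have d := d1.hasDerivAt.fun_mul (d2.fun_mul d3)
    rw [e, d.deriv, sum_range_succ]
    have i1 := h1 N
    have i2 := h2 N
    have : x * (x ^ 2)⁻¹ = x⁻¹ := by field_simp
    have e4 : x * Q ^ N / (1 + x * Q ^ N) * (1 + x * Q ^ N) = x * Q ^ N := div_mul_cancel₀ _ i2
    have e5 : x⁻¹ * Q ^ (N+1) / (1 + x⁻¹ * Q ^ (N+1)) * (1 + x⁻¹ * Q ^ (N+1)) = x⁻¹ * Q ^ (N+1) :=
      div_mul_cancel₀ _ i1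
    linear_combination (-(1 + x⁻¹ * Q ^ (N+1)) * G Q N x) * e4
      + (1 + x * Q ^ N) * G Q N x * e5 - Q ^ (N+1) * (1 + x * Q ^ N) * G Q N x * this
      + (1 + x⁻¹ * Q ^ (N+1)) * (1 + x * Q ^ N) * ih

lemma G_deriv_neg_one {Q : ℂ} (N : ℕ) :
    (-1) * deriv (G Q (N + 1)) (-1) = - (a Q (N + 1) * a Q N) := by
  have e : G Q (N + 1) = fun x => (1 + x) * ((∏ i ∈ range (N + 1), (1 + x⁻¹ * Q ^ (i + 1))) *
      ∏ i ∈ range N, (1 + x * Q ^ (i + 1))) := by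
    ext y; simp only [G]; rw [prod_range_succ' (fun i => 1 + y * Q ^ i)]; simp only [pow_zero, mul_one]; ring
  have d1 : DifferentiableAt ℂ (fun x : ℂ => ((∏ i ∈ range (N + 1), (1 + x⁻¹ * Q ^ (i + 1))) *
      ∏ i ∈ range N, (1 + x * Q ^ (i + 1)))) (-1) := by
    apply DifferentiableAt.fun_mul
    · apply DifferentiableAt.fun_finsetProd
      intro i _
      exact ((differentiableAt_inv (by norm_num)).mul_const _).const_add _
    · apply DifferentiableAt.fun_finsetProd
      intro i _
      fun_prop
  have d2 : HasDerivAt (fun x : ℂ => 1 + x) 1 (-1) := (hasDerivAt_id _).const_add _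
  rw [e, (d2.fun_mul d1.hasDerivAt).deriv]
  simp only [a, pow_succ']
  simp [inv_neg, sub_eq_add_neg]

lemma summable_geo {Q : ℂ} (hQ : ‖Q‖ < 1) (z : ℂ) : Summable (fun j : ℕ => ‖-(z * Q ^ j)‖) := by
  simp only [norm_neg, norm_mul, norm_pow]
  exact (summable_geometric_of_lt_one (norm_nonneg _) hQ).mul_left _

lemma tendsto_poch {Q : ℂ} (hQ : ‖Q‖ < 1) (z : ℂ) :
    Tendsto (fun N => ∏ j ∈ range N, (1 - z * Q ^ j)) atTop (𝓝 (qPochhammerInf z Q)) := by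
  have := (multipliable_one_add_of_summable (summable_geo hQ z)).tendsto_prod_tprod_nat
  simpa only [← sub_eq_add_neg, qPochhammerInf] using this

lemma tendsto_a {Q : ℂ} (hQ : ‖Q‖ < 1) : Tendsto (a Q) atTop (𝓝 (qPochhammerInf Q Q)) :=
  tendsto_poch hQ Q

lemma poch_ne {Q : ℂ} (hQ : ‖Q‖ < 1) : qPochhammerInf Q Q ≠ 0 := by
  have := tprod_one_add_ne_zero_of_summable (f := fun j : ℕ => -(Q * Q ^ j)) (fun i => by
    rw [← sub_eq_add_neg]; exact one_sub_ne (norm_mul_pow_lt hQ hQ i)) (summable_geo hQ Q)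
  simpa only [← sub_eq_add_neg, qPochhammerInf] using this

lemma b_bound {Q : ℂ} (hQ : ‖Q‖ < 1) : ∃ C, ∀ n k, ‖b Q n k‖ ≤ C := by
  obtain ⟨C1, h1⟩ := (Metric.isBounded_range_of_tendsto _ (tendsto_a hQ)).exists_norm_le
  obtain ⟨C2, h2⟩ := (Metric.isBounded_range_of_tendsto _
    ((tendsto_a hQ).inv₀ (poch_ne hQ))).exists_norm_le
  have g1 : ∀ n, ‖a Q n‖ ≤ C1 := fun n => h1 _ ⟨n, rfl⟩
  have g2 : ∀ n, ‖(a Q n)⁻¹‖ ≤ C2 := fun n => h2 _ ⟨n, rfl⟩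
  have p1 : 0 ≤ C1 := (norm_nonneg _).trans (g1 0)
  have p2 : 0 ≤ C2 := (norm_nonneg _).trans (g2 0)
  refine ⟨C1 * (C2 * C2), fun n k => ?_⟩
  unfold b
  split_ifs
  · rw [div_eq_mul_inv, mul_inv, norm_mul, norm_mul]
    exact mul_le_mul (g1 _) (mul_le_mul (g2 _) (g2 _) (norm_nonneg _) p2) (by positivity) p1
  · simp; positivity

lemma tannery {Q : ℂ} (hQ : ‖Q‖ < 1) (t : ℤ → ℂ) (ht : Summable t) :
    Tendsto (fun N : ℕ => ∑ k ∈ range (2 * N + 1), b Q (2 * N) k * t ((k : ℤ) - N)) atTop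
      (𝓝 ((qPochhammerInf Q Q)⁻¹ * ∑' m, t m)) := by
  obtain ⟨C, hC⟩ := b_bound hQ
  have hC0 : 0 ≤ C := (norm_nonneg _).trans (hC 0 0)
  let f : ℕ → ℤ → ℂ := fun N m => (if 0 ≤ m + N then b Q (2 * N) (m + N).toNat else 0) * t m
  have hf : ∀ N : ℕ, ∑ k ∈ range (2 * N + 1), b Q (2 * N) k * t ((k : ℤ) - N) = ∑' m, f N m := by
    intro N
    have hinj : Function.Injective (fun k : ℕ => (k : ℤ) - N) := by
      intro i j h; simp only at h; omega
    rw [← hinj.tsum_eq]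
    · rw [tsum_eq_sum (s := range (2 * N + 1))]
      · apply sum_congr rfl
        intro k _
        simp [f]
      · intro k hk
        have hk' : ¬ (k ≤ 2 * N) := by simpa [Nat.lt_succ_iff] using hk
        simp only [f, sub_add_cancel, Int.toNat_natCast, b, hk', if_false]
        simp
    · intro m hm
      have : 0 ≤ m + N := by
        by_contra h
        apply hm
        simp only [f, h, if_false, zero_mul]
      exact ⟨(m + N).toNat, by simp only; omega⟩
  simp only [hf]
  rw [← tsum_mul_left]
  apply tendsto_tsum_of_dominated_convergence (bound := fun m => C * ‖t m‖) (ht.norm.mul_left C)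
  · intro m
    apply Tendsto.mul_const
    have hlim : Tendsto (fun N : ℕ => a Q (2 * N) / (a Q (m + N).toNat * a Q (2 * N - (m + N).toNat)))
        atTop (𝓝 (qPochhammerInf Q Q / (qPochhammerInf Q Q * qPochhammerInf Q Q))) := by
      have hA := tendsto_a hQ
      apply Tendsto.div
      · apply hA.comp
        exact tendsto_atTop_atTop.mpr fun c => ⟨c, fun n hn => by omega⟩
      · apply Tendsto.mul
        · apply hA.comp
          exact tendsto_atTop_atTop.mpr fun c => ⟨c + m.natAbs, fun n hn => by omega⟩
        · apply hA.comp
          exact tendsto_atTop_atTop.mpr fun c => ⟨c + m.natAbs, fun n hn => by omega⟩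
      · exact mul_ne_zero (poch_ne hQ) (poch_ne hQ)
    have hv : qPochhammerInf Q Q / (qPochhammerInf Q Q * qPochhammerInf Q Q)
        = (qPochhammerInf Q Q)⁻¹ := by
      have := poch_ne hQ
      field_simp
    rw [hv] at hlim
    apply hlim.congr'
    filter_upwards [eventually_ge_atTop m.natAbs] with N hN
    rw [if_pos (by omega), b, if_pos (by omega)]
  · filter_upwards with N m
    simp only [f, norm_mul]
    gcongr
    split_ifs
    · exact hC _ _
    · simpa using hC0

lemma term_eq {Q x : ℂ} (hQ0 : Q ≠ 0) (hx : x ≠ 0) (m : ℤ) :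
    Q ^ T m * x ^ m = jacobiTheta₂_term m ((Complex.log x - Complex.log Q / 2) / (2 * Real.pi * Complex.I))
      (Complex.log Q / (2 * Real.pi * Complex.I)) := by
  have hpi : (Real.pi : ℂ) ≠ 0 := by exact_mod_cast Real.pi_ne_zero
  have hI := Complex.I_ne_zero
  unfold jacobiTheta₂_term
  have h1 : Q ^ T m = Complex.exp (T m * Complex.log Q) := by
    rw [Complex.exp_int_mul, Complex.exp_log hQ0]
  have h2 : x ^ m = Complex.exp (m * Complex.log x) := by
    rw [Complex.exp_int_mul, Complex.exp_log hx]
  rw [h1, h2, ← Complex.exp_add]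
  congr 1
  have := two_T m
  have t : (2 : ℂ) * (T m : ℂ) = m * (m - 1) := by exact_mod_cast this
  field_simp
  linear_combination Complex.log Q * t

lemma im_pos {Q : ℂ} (hQ : ‖Q‖ < 1) (hQ0 : Q ≠ 0) :
    0 < (Complex.log Q / (2 * Real.pi * Complex.I)).im := by
  have h1 : Complex.log Q / (2 * Real.pi * Complex.I)
      = ((1 / (2 * Real.pi) : ℝ) : ℂ) * (-Complex.I * Complex.log Q) := by
    have hpi : (Real.pi : ℂ) ≠ 0 := by exact_mod_cast Real.pi_ne_zero
    have hI := Complex.I_ne_zero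
    push_cast
    field_simp
    linear_combination Complex.log Q * Complex.I_sq
  rw [h1, Complex.im_ofReal_mul]
  have h2 : (-Complex.I * Complex.log Q).im = - Real.log ‖Q‖ := by
    simp [Complex.log_re]
  rw [h2]
  have := Real.log_neg (norm_pos_iff.mpr hQ0) hQ
  have := Real.pi_pos
  have : 0 < -Real.log ‖Q‖ := by linarith
  positivity

lemma summable0 {Q x : ℂ} (hQ : ‖Q‖ < 1) (hQ0 : Q ≠ 0) (hx : x ≠ 0) :
    Summable fun m : ℤ => Q ^ T m * x ^ m := by
  simp only [term_eq hQ0 hx]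
  exact (summable_jacobiTheta₂_term_iff _ _).mpr (im_pos hQ hQ0)

lemma summable1 {Q x : ℂ} (hQ : ‖Q‖ < 1) (hQ0 : Q ≠ 0) (hx : x ≠ 0) :
    Summable fun m : ℤ => (m : ℂ) * (Q ^ T m * x ^ m) := by
  simp only [term_eq hQ0 hx]
  have h := (summable_jacobiTheta₂'_term_iff
    ((Complex.log x - Complex.log Q / 2) / (2 * Real.pi * Complex.I))
    (Complex.log Q / (2 * Real.pi * Complex.I))).mpr (im_pos hQ hQ0)
  have h' := h.mul_left (2 * Real.pi * Complex.I)⁻¹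
  refine h'.congr fun m => ?_
  have hpi : (Real.pi : ℂ) ≠ 0 := by exact_mod_cast Real.pi_ne_zero
  have hI := Complex.I_ne_zero
  simp only [jacobiTheta₂'_term]
  field_simp

lemma tendsto_G {Q x : ℂ} (hQ : ‖Q‖ < 1) :
    Tendsto (fun N => G Q N x) atTop
      (𝓝 (qPochhammerInf (-(x⁻¹ * Q)) Q * qPochhammerInf (-x) Q)) := by
  have := (tendsto_poch hQ (-(x⁻¹ * Q))).mul (tendsto_poch hQ (-x))
  refine this.congr fun N => ?_
  simp only [G, pow_succ']
  congr 1
  · exact prod_congr rfl fun i _ => by ring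
  · exact prod_congr rfl fun i _ => by ring

lemma jtp {Q x : ℂ} (hQ : ‖Q‖ < 1) (hQ0 : Q ≠ 0) (hx : x ≠ 0) :
    qPochhammerInf (-(x⁻¹ * Q)) Q * qPochhammerInf (-x) Q * qPochhammerInf Q Q
      = ∑' m : ℤ, Q ^ T m * x ^ m := by
  have h1 := tannery hQ _ (summable0 hQ hQ0 hx)
  have h2 := (tendsto_G (x := x) hQ).congr (fun N => finite_jtp hQ hQ0 hx N)
  have h3 := tendsto_nhds_unique h2 h1
  have := poch_ne hQ
  rw [h3]; field_simp

lemma summable_lambert {Q z : ℂ} (hQ : ‖Q‖ < 1) (hz : ‖z‖ < 1) :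
    Summable fun n : ℕ => z * Q ^ n / (1 + z * Q ^ n) := by
  have hz' : 0 < 1 - ‖z‖ := by linarith
  have hs : Summable fun n : ℕ => ‖z‖ / (1 - ‖z‖) * ‖Q‖ ^ n :=
    (summable_geometric_of_lt_one (norm_nonneg _) hQ).mul_left _
  refine hs.of_norm_bounded fun n => ?_
  have h1 : ‖z * Q ^ n‖ ≤ ‖z‖ := by
    rw [norm_mul, norm_pow]
    exact mul_le_of_le_one_right (norm_nonneg _) (pow_le_one₀ (norm_nonneg _) hQ.le)
  have h2 : 1 - ‖z‖ ≤ ‖1 + z * Q ^ n‖ := by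
    have := norm_sub_norm_le (1 : ℂ) (-(z * Q ^ n))
    rw [norm_one, norm_neg, sub_neg_eq_add] at this
    linarith
  rw [norm_div]
  calc ‖z * Q ^ n‖ / ‖1 + z * Q ^ n‖ ≤ ‖z * Q ^ n‖ / (1 - ‖z‖) := by gcongr
    _ = _ := by rw [norm_mul, norm_pow]; ring

lemma jtp' {Q x : ℂ} (hQ : ‖Q‖ < 1) (hQ0 : Q ≠ 0) (hx : x ≠ 0) (hx1 : ‖x‖ < 1)
    (hx2 : ‖x⁻¹ * Q‖ < 1) :
    qPochhammerInf (-(x⁻¹ * Q)) Q * qPochhammerInf (-x) Q * qPochhammerInf Q Q *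
      (∑' n : ℕ, (x * Q ^ n / (1 + x * Q ^ n) - (x⁻¹ * Q) * Q ^ n / (1 + (x⁻¹ * Q) * Q ^ n)))
      = ∑' m : ℤ, (m : ℂ) * (Q ^ T m * x ^ m) := by
  have h1 := tannery hQ _ (summable1 hQ hQ0 hx)
  have e : ∀ i : ℕ, x⁻¹ * Q ^ (i + 1) = (x⁻¹ * Q) * Q ^ i := fun i => by rw [pow_succ']; ring
  have n1 : ∀ z : ℂ, ‖z‖ < 1 → ∀ i : ℕ, 1 + z * Q ^ i ≠ 0 := by
    intro z hz i
    have := one_sub_ne (norm_mul_pow_lt (z := -z) (by simpa using hz) hQ i)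
    intro h; apply this; linear_combination h
  have h2 := (tendsto_G (x := x) hQ).mul
    ((summable_lambert hQ hx1).sub (summable_lambert hQ hx2)).hasSum.tendsto_sum_nat
  have h3 : ∀ N, G Q N x * ∑ n ∈ range N,
      (x * Q ^ n / (1 + x * Q ^ n) - (x⁻¹ * Q) * Q ^ n / (1 + (x⁻¹ * Q) * Q ^ n)) =
      ∑ k ∈ range (2 * N + 1), b Q (2 * N) k *
          ((((k : ℤ) - N : ℤ) : ℂ) * (Q ^ T ((k : ℤ) - N) * x ^ ((k : ℤ) - N))) := fun N => by
    rw [← finite_deriv hQ hQ0 hx N, G_deriv hx N (fun i => by rw [e]; exact n1 _ hx2 i) (n1 _ hx1)]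
    simp only [e]
  have h4 := tendsto_nhds_unique (h2.congr h3) h1
  have := poch_ne hQ
  rw [mul_right_comm, h4]; field_simp

lemma jac1 {Q : ℂ} (hQ : ‖Q‖ < 1) (hQ0 : Q ≠ 0) :
    ∑' m : ℤ, (m : ℂ) * (Q ^ T m * (-1) ^ m) = - qPochhammerInf Q Q ^ 3 := by
  have hx : (-1 : ℂ) ≠ 0 := by norm_num
  have h1 := (tannery hQ _ (summable1 hQ hQ0 hx)).comp (tendsto_add_atTop_nat 1)
  have hA := tendsto_a hQ
  have h2 := ((hA.comp (tendsto_add_atTop_nat 1)).mul hA).neg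
  have h3 := h2.congr (fun N => (G_deriv_neg_one (Q := Q) N).symm.trans
    (finite_deriv hQ hQ0 hx (N + 1)))
  have h4 := tendsto_nhds_unique h3 h1
  have := poch_ne hQ
  have h5 : (qPochhammerInf Q Q) * (qPochhammerInf Q Q)⁻¹ = 1 := mul_inv_cancel₀ this
  linear_combination (-qPochhammerInf Q Q) * h4 - (∑' m : ℤ, (m : ℂ) * (Q ^ T m * (-1) ^ m)) * h5

/-- General term of the Jacobi series. -/
noncomputable def g (q : ℂ) (n : ℤ) : ℂ := (2 * n + 1) * (-1) ^ n * q ^ T (n + 1)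

lemma g_symm (q : ℂ) (n : ℤ) : g q (-1 - n) = g q n := by
  unfold g
  have h1 : T (-1 - n + 1) = T (n + 1) := by
    unfold T; congr 1; ring
  have h2 : ((-1 : ℂ)) ^ (-1 - n) = - (-1) ^ n := by
    rw [zpow_sub₀ (by norm_num)]
    rcases Int.even_or_odd n with h | h
    · simp [h.neg_one_zpow]
    · simp [h.neg_one_zpow]
  rw [h1, h2]; push_cast; ring

lemma hasSum_of_eq {f f' : ℤ → ℂ} {s : ℂ} (h : HasSum f s) (e : ∀ n, f' n = f n) :
    HasSum f' s := by
  rw [funext e]; exact h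

lemma g_hasSum {q : ℂ} (hq : ‖q‖ < 1) (hq0 : q ≠ 0) : HasSum (g q) (2 * qPochhammerInf q q ^ 3) := by
  have hx : (-1 : ℂ) ≠ 0 := by norm_num
  have h1 := (summable1 hq hq0 hx).hasSum
  rw [jac1 hq hq0] at h1
  have h2 := (Equiv.addRight (1 : ℤ)).hasSum_iff.mpr h1
  have h3 := (Equiv.subLeft (0 : ℤ)).hasSum_iff.mpr h1
  have h4 := (h2.add h3).neg
  have e1 : -(-qPochhammerInf q q ^ 3 + -qPochhammerInf q q ^ 3) = 2 * qPochhammerInf q q ^ 3 := by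
    ring
  rw [e1] at h4
  refine hasSum_of_eq h4 fun n => ?_
  have h1 : T (-n) = T (n + 1) := by
    unfold T; congr 1; ring
  simp only [g, Function.comp_apply, Equiv.coe_addRight, Equiv.subLeft_apply, zero_sub, h1]
  rw [zpow_add₀ hx, zpow_neg, ← inv_zpow]
  have h2 : ((-1 : ℂ))⁻¹ = -1 := by norm_num
  rw [h2, zpow_one]
  push_cast
  ring

lemma split_sum {q : ℂ} (hq : ‖q‖ < 1) (hq0 : q ≠ 0) (h : ℕ) (hh : 0 < h) :
    qPochhammerInf q q ^ 3 = ∑ l ∈ range h, ∑' m : ℤ, g q (m * (2 * h : ℕ) + l) := by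
  have : NeZero (2 * h) := ⟨by omega⟩
  let F : ℕ → ℂ := fun r => ∑' m : ℤ, g q (m * (2 * h : ℕ) + r)
  have h1 := g_hasSum hq hq0
  have h2 := (((Equiv.prodComm (Fin (2 * h)) ℤ).trans (Int.divModEquiv (2 * h)).symm).hasSum_iff).mpr h1
  have h3 : ∀ r : Fin (2 * h), HasSum (fun m : ℤ => g q (m * (2 * h : ℕ) + (r : ℕ))) (F r) := by
    intro r
    have := (h2.summable.prod_factor r).hasSum
    exact this
  have h4 := h2.prod_fiberwise h3
  have h5 := h4.unique (hasSum_fintype _)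
  rw [Fin.sum_univ_eq_sum_range] at h5
  rw [two_mul h, sum_range_add] at h5
  have hsym : ∀ r ∈ range h, F (h + (h - 1 - r)) = F r := by
    intro r hr
    have hr' : r < h := by simpa using hr
    simp only [F]
    rw [← (Equiv.subLeft (-1 : ℤ)).tsum_eq]
    apply tsum_congr
    intro m
    rw [← g_symm]
    congr 1
    simp only [Equiv.subLeft_apply]
    have : ((h + (h - 1 - r) : ℕ) : ℤ) = 2 * h - 1 - r := by omega
    rw [this]; push_cast; ring
  rw [← sum_range_reflect (fun x => F (h + x)), sum_congr rfl hsym] at h5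
  change _ = ∑ l ∈ range h, F l
  linear_combination h5 / 2

lemma one_term {q : ℂ} (hq : ‖q‖ < 1) (hq0 : q ≠ 0) (l d h : ℕ) (hh : h = l + d + 1) :
    ∑' m : ℤ, g q (m * (2 * h : ℕ) + l) =
      (-1 : ℂ) ^ l * q ^ (l * (l + 1) / 2) *
          (qPochhammerInf (-(q ^ (h * (2 * d + 1)))) (q ^ ((2 * h) ^ 2)) *
            qPochhammerInf (-(q ^ (h * (2 * h + 1 + 2 * l)))) (q ^ ((2 * h) ^ 2)) *
            qPochhammerInf (q ^ ((2 * h) ^ 2)) (q ^ ((2 * h) ^ 2))) *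
          ((2 * l + 1 : ℕ) - 2 * ((2 * h : ℕ) : ℂ) *
            ∑' n : ℕ,
              (q ^ ((2 * h) ^ 2 * n + h * (2 * d + 1)) /
                  (1 + q ^ ((2 * h) ^ 2 * n + h * (2 * d + 1))) -
                q ^ ((2 * h) ^ 2 * n + h * (2 * h + 1 + 2 * l)) /
                  (1 + q ^ ((2 * h) ^ 2 * n + h * (2 * h + 1 + 2 * l))))) := by
  have hpos : 0 < h := by omega
  have small : ∀ n : ℕ, 0 < n → ‖q ^ n‖ < 1 := fun n hn => by
    rw [norm_pow]; exact pow_lt_one₀ (norm_nonneg _) hq (by omega)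
  have hQ : ‖q ^ ((2 * h) ^ 2)‖ < 1 := small _ (by positivity)
  have hB : ‖q ^ (h * (2 * h + 1 + 2 * l))‖ < 1 := small _ (by positivity)
  have hA : ‖q ^ (h * (2 * d + 1))‖ < 1 := small _ (by positivity)
  have hQ0 : q ^ ((2 * h) ^ 2) ≠ 0 := pow_ne_zero _ hq0
  have hB0 : q ^ (h * (2 * h + 1 + 2 * l)) ≠ 0 := pow_ne_zero _ hq0
  have hAB : (q ^ (h * (2 * h + 1 + 2 * l)))⁻¹ * q ^ ((2 * h) ^ 2) = q ^ (h * (2 * d + 1)) := by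
    have : (2 * h) ^ 2 = h * (2 * h + 1 + 2 * l) + h * (2 * d + 1) := by rw [hh]; ring
    rw [this, pow_add]; field_simp
  have J0 := jtp hQ hQ0 hB0
  have J1 := jtp' hQ hQ0 hB0 hB (by rw [hAB]; exact hA)
  have S0 := summable0 hQ hQ0 hB0
  have S1 := summable1 hQ hQ0 hB0
  rw [hAB] at J0 J1
  have hterm : ∀ m : ℤ, g q (m * (2 * h : ℕ) + l) = (-1 : ℂ) ^ l * q ^ (l * (l + 1) / 2) *
      ((2 * l + 1 : ℕ) * ((q ^ ((2 * h) ^ 2)) ^ T m * (q ^ (h * (2 * h + 1 + 2 * l))) ^ m)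
        + 2 * ((2 * h : ℕ) : ℂ) *
          (m * ((q ^ ((2 * h) ^ 2)) ^ T m * (q ^ (h * (2 * h + 1 + 2 * l))) ^ m))) := by
    intro m
    have e1 : (-1 : ℂ) ^ (m * (2 * h : ℕ) + l : ℤ) = (-1) ^ l := by
      rw [zpow_add₀ (by norm_num), zpow_natCast]
      have : Even (m * (2 * h : ℕ) : ℤ) := ⟨m * h, by push_cast; ring⟩
      rw [this.neg_one_zpow, one_mul]
    have e2 : q ^ T (m * (2 * h : ℕ) + l + 1) = q ^ (l * (l + 1) / 2) *
        ((q ^ ((2 * h) ^ 2)) ^ T m * (q ^ (h * (2 * h + 1 + 2 * l))) ^ m) := by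
      rw [← zpow_natCast, ← zpow_natCast, ← zpow_natCast, ← zpow_mul, ← zpow_mul,
        ← zpow_add₀ hq0, ← zpow_add₀ hq0]
      congr 1
      have t1 := two_T (m * (2 * h : ℕ) + l + 1)
      have t2 := two_T m
      have t3 : 2 * ((l * (l + 1) / 2 : ℕ) : ℤ) = l * (l + 1) := by
        have := Nat.mul_div_cancel' (Nat.even_mul_succ_self l).two_dvd
        exact_mod_cast this
      generalize ((l * (l + 1) / 2 : ℕ) : ℤ) = u at *
      generalize T (m * (2 * h : ℕ) + l + 1) = v at *
      push_cast at *
      apply mul_left_cancel₀ (two_ne_zero : (2 : ℤ) ≠ 0)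
      linear_combination t1 - t3 - 4 * (h : ℤ) ^ 2 * t2
    unfold g
    rw [e1, e2]
    push_cast
    ring
  simp only [hterm]
  rw [tsum_mul_left, (S0.mul_left _).tsum_add (S1.mul_left _), tsum_mul_left, tsum_mul_left, ← J0, ← J1]
  have hs : ∑' n : ℕ,
              (q ^ ((2 * h) ^ 2 * n + h * (2 * d + 1)) /
                  (1 + q ^ ((2 * h) ^ 2 * n + h * (2 * d + 1))) -
                q ^ ((2 * h) ^ 2 * n + h * (2 * h + 1 + 2 * l)) /
                  (1 + q ^ ((2 * h) ^ 2 * n + h * (2 * h + 1 + 2 * l))))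
      = - ∑' n : ℕ, (q ^ (h * (2 * h + 1 + 2 * l)) * (q ^ ((2 * h) ^ 2)) ^ n /
            (1 + q ^ (h * (2 * h + 1 + 2 * l)) * (q ^ ((2 * h) ^ 2)) ^ n)
          - q ^ (h * (2 * d + 1)) * (q ^ ((2 * h) ^ 2)) ^ n /
            (1 + q ^ (h * (2 * d + 1)) * (q ^ ((2 * h) ^ 2)) ^ n)) := by
    rw [← tsum_neg]
    apply tsum_congr
    intro n
    rw [neg_sub]
    have e : ∀ c : ℕ, q ^ ((2 * h) ^ 2 * n + c) = q ^ c * (q ^ ((2 * h) ^ 2)) ^ n := fun c => by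
      rw [← pow_mul, ← pow_add, add_comm]
    rw [e, e]
  rw [hs]
  ring

end CubeEta

/-- the main identity for `(q;q)_∞³` when `k` is a positive even integer. -/
theorem cube_eta_identity_even (k : ℕ) (hk : 0 < k) (hke : Even k)
    (q : ℂ) (hq : ‖q‖ < 1) :
    (qPochhammerInf q q) ^ 3 =
      ∑ l ∈ Finset.range (k / 2),
        (-1 : ℂ) ^ l * q ^ (l * (l + 1) / 2) *
          (qPochhammerInf (-(q ^ (k * (k - 1 - 2 * l) / 2))) (q ^ (k ^ 2)) *
            qPochhammerInf (-(q ^ (k * (k + 1 + 2 * l) / 2))) (q ^ (k ^ 2)) *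
            qPochhammerInf (q ^ (k ^ 2)) (q ^ (k ^ 2))) *
          ((2 * l + 1 : ℕ) - 2 * (k : ℂ) *
            ∑' n : ℕ,
              (q ^ (k ^ 2 * n + k * (k - 1 - 2 * l) / 2) /
                  (1 + q ^ (k ^ 2 * n + k * (k - 1 - 2 * l) / 2)) -
                q ^ (k ^ 2 * n + k * (k + 1 + 2 * l) / 2) /
                  (1 + q ^ (k ^ 2 * n + k * (k + 1 + 2 * l) / 2)))) := by
  obtain ⟨h, hkh⟩ := hke
  obtain rfl : k = 2 * h := by omega
  have hpos : 0 < h := by omega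
  have hdiv : 2 * h / 2 = h := by omega
  have hmul : ∀ c : ℕ, 2 * h * c / 2 = h * c := fun c => by
    rw [mul_assoc]; exact Nat.mul_div_cancel_left _ (by norm_num)
  simp only [hdiv, hmul]
  by_cases hq0 : q = 0
  · subst hq0
    have hP : ∀ c : ℂ, qPochhammerInf 0 c = 1 := fun c => by simp [qPochhammerInf]
    rw [Finset.sum_eq_single_of_mem 0 (by simpa using hpos)]
    · have e1 : h * (2 * h - 1 - 2 * 0) ≠ 0 := Nat.mul_ne_zero (by omega) (by omega)
      have e2 : h * (2 * h + 1 + 2 * 0) ≠ 0 := Nat.mul_ne_zero (by omega) (by omega)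
      have e3 : (2 * h) ^ 2 ≠ 0 := by positivity
      have e4 : ∀ n c : ℕ, c ≠ 0 → (0 : ℂ) ^ ((2 * h) ^ 2 * n + c) = 0 := fun n c hc =>
        zero_pow (by omega)
      simp only [e4 _ _ e1, e4 _ _ e2, zero_pow e1, zero_pow e2, zero_pow e3, neg_zero, hP]
      simp
    · intro l _ hl
      have : l * (l + 1) / 2 ≠ 0 := by
        have : 2 ≤ l * (l + 1) := by
          have : 1 ≤ l := by omega
          nlinarith
        omega
      rw [zero_pow this]; simp
  · rw [CubeEta.split_sum hq hq0 h hpos]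
    apply Finset.sum_congr rfl
    intro l hl
    have hl' : l < h := by simpa using hl
    obtain ⟨d, hd⟩ : ∃ d, h = l + d + 1 := ⟨h - l - 1, by omega⟩
    have e1 : 2 * h - 1 - 2 * l = 2 * d + 1 := by omega
    rw [e1]
    exact CubeEta.one_term hq hq0 l d h hd
end

section
/- Let k be a positive odd integer and let q be a complex number with ‖q‖ < 1. Then (q;q)_∞³ − (−1)^{(k−1)/2} · k · q^{(k²−1)/8} · (q^{k²};q^{k²})_∞³ = Σ_{ℓ=0}^{(k−3)/2} (−1)^ℓ q^{ℓ(ℓ+1)/2} · (q^{k(k−1−2ℓ)/2}, q^{k(k+1+2ℓ)/2}, q^{k²}; q^{k²})_∞ · ( 2ℓ+1 + 2k·Σ_{n≥0} [ q^{k(kn+(k−1−2ℓ)/2)}/(1 − q^{k(kn+(k−1−2ℓ)/2)}) − q^{k(kn+(k+1+2ℓ)/2)}/(1 − q^{k(kn+(k+1+2ℓ)/2)}) ] ). (Since k is odd, all exponents occurring are nonnegative integers, and all infinite products and series converge absolutely.) -/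
open Filter Topology

/-- finite q-Pochhammer symbol -/
noncomputable def fpoch (a q : ℂ) (n : ℕ) : ℂ := ∏ j ∈ Finset.range n, (1 - a * q ^ j)

/-- Gaussian binomial coefficient -/
noncomputable def qbin (q : ℂ) : ℕ → ℕ → ℂ
  | _, 0 => 1
  | 0, _ + 1 => 0
  | n + 1, k + 1 => qbin q n k + q ^ (k + 1) * qbin q n (k + 1)

/-- the terms of the theta series -/
noncomputable def eterm (q z : ℂ) (m : ℤ) : ℂ := (-1) ^ m * q ^ (m * (m - 1) / 2) * z ^ m

lemma qbin_zero_right (q : ℂ) (n : ℕ) : qbin q n 0 = 1 := by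
  cases n <;> simp [qbin]

lemma qbin_eq_zero (q : ℂ) : ∀ (n k : ℕ), n < k → qbin q n k = 0
  | 0, k + 1, _ => by simp [qbin]
  | n + 1, k + 1, h => by
    simp [qbin, qbin_eq_zero q n k (by omega), qbin_eq_zero q n (k + 1) (by omega)]

lemma fpoch_succ (a q : ℂ) (n : ℕ) : fpoch a q (n + 1) = fpoch a q n * (1 - a * q ^ n) := by
  simp [fpoch, Finset.prod_range_succ]

lemma qbin_mul (q : ℂ) : ∀ (n k : ℕ), k ≤ n →
    qbin q n k * (fpoch q q k * fpoch q q (n - k)) = fpoch q q n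
  | n, 0, _ => by simp [qbin_zero_right, fpoch]
  | n + 1, k + 1, h => by
    have h1 := qbin_mul q n k (by omega)
    rcases Nat.lt_or_ge n (k + 1) with h2 | h2
    · have : n = k := by omega
      subst this
      rw [qbin, qbin_eq_zero q n (n + 1) (by omega)]
      simp only [Nat.sub_self] at h1 ⊢
      rw [fpoch_succ]
      linear_combination (1 - q * q ^ n) * h1
    · have h3 := qbin_mul q n (k + 1) h2
      obtain ⟨d, rfl⟩ : ∃ d, n = k + 1 + d := ⟨n - (k + 1), by omega⟩
      rw [show k + 1 + d - k = d + 1 by omega] at h1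
      rw [show k + 1 + d - (k + 1) = d by omega] at h3
      rw [show k + 1 + d + 1 - (k + 1) = d + 1 by omega, qbin, fpoch_succ q q (k + 1 + d)]
      rw [fpoch_succ q q k] at h3 ⊢
      rw [fpoch_succ q q d] at h1 ⊢
      have e : q * q ^ (k + 1 + d) = (q * q ^ k) * (q * q ^ d) := by ring
      rw [e]
      linear_combination (1 - q * q ^ k) * h1 + q ^ (k + 1) * (1 - q * q ^ d) * h3

lemma rothe (q : ℂ) (n : ℕ) : ∀ x : ℂ, ∏ j ∈ Finset.range n, (1 + x * q ^ j) =
    ∑ k ∈ Finset.range (n + 1), qbin q n k * (q ^ (k.choose 2) * x ^ k) := by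
  induction n with
  | zero => intro x; simp [qbin]
  | succ n ih =>
    intro x
    rw [Finset.prod_range_succ']
    have : ∀ j, 1 + x * q ^ (j + 1) = 1 + (x * q) * q ^ j := fun j => by ring
    simp only [this, ih]
    rw [Finset.sum_range_succ' _ (n + 1)]
    have e : ∀ k, qbin q (n + 1) (k + 1) * (q ^ ((k + 1).choose 2) * x ^ (k + 1)) =
        x * (qbin q n k * (q ^ (k.choose 2) * (x * q) ^ k)) +
        qbin q n (k + 1) * (q ^ ((k + 1).choose 2) * (x * q) ^ (k + 1)) := by
      intro k
      rw [qbin, Nat.choose_succ_succ' k 1, Nat.choose_one_right, pow_add, mul_pow, mul_pow]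
      ring
    simp only [e, Finset.sum_add_distrib, ← Finset.mul_sum]
    have e2 := Finset.sum_range_succ' (fun k => qbin q n k * (q ^ (k.choose 2) * (x * q) ^ k)) (n + 1)
    rw [Finset.sum_range_succ, qbin_eq_zero q n (n + 1) (by omega)] at e2
    simp only [qbin_zero_right] at e2 ⊢
    simp at e2 ⊢
    linear_combination e2

lemma half_succ (m : ℤ) : (m + 1) * (m + 1 - 1) / 2 = m * (m - 1) / 2 + m := by
  have : (m + 1) * (m + 1 - 1) = m * (m - 1) + m * 2 := by ring
  rw [this, Int.add_mul_ediv_right _ _ (by norm_num)]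

lemma eterm_succ {q z : ℂ} (hq : q ≠ 0) (hz : z ≠ 0) (m : ℤ) :
    eterm q z (m + 1) = -z * q ^ m * eterm q z m := by
  unfold eterm
  rw [half_succ, zpow_add₀ hq, zpow_add₀ hz, zpow_add₀ (by norm_num : (-1 : ℂ) ≠ 0)]
  simp
  ring

lemma eterm_zero (q z : ℂ) : eterm q z 0 = 1 := by simp [eterm]

lemma finite_jtp {q z : ℂ} (hq : q ≠ 0) (hz : z ≠ 0) (N : ℕ) :
    fpoch z q N * fpoch (q / z) q N =
      ∑ k ∈ Finset.range (2 * N + 1), qbin q (2 * N) k * eterm q z ((k : ℤ) - N) := by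
  set c : ℕ → ℂ := fun N => ∏ i ∈ Finset.range N, (-z * (q ^ (i + 1))⁻¹) with hc
  have hc1 : ∀ N : ℕ, eterm q z (-(N : ℤ)) * c N = 1 := by
    intro N
    induction N with
    | zero => simp [hc, eterm_zero]
    | succ n ih =>
      have h := eterm_succ hq hz (-((n + 1 : ℕ) : ℤ))
      rw [show -((n + 1 : ℕ) : ℤ) + 1 = -(n : ℤ) by push_cast; ring] at h
      rw [h] at ih
      simp only [hc, Finset.prod_range_succ] at ih ⊢
      rw [← ih, zpow_neg, zpow_natCast]
      ring
  have hcn : c N ≠ 0 := fun h => by simpa [h] using hc1 N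
  have hc2 : ∀ k : ℕ, eterm q z ((k : ℤ) - N) * c N =
      q ^ (k.choose 2) * (-z * (q ^ N)⁻¹) ^ k := by
    intro k
    induction k with
    | zero => simpa using hc1 N
    | succ k ih =>
      rw [show ((k + 1 : ℕ) : ℤ) - N = (k - N : ℤ) + 1 by push_cast; ring, eterm_succ hq hz,
        Nat.choose_succ_succ' k 1, Nat.choose_one_right, pow_add, pow_succ, mul_assoc, ih,
        zpow_sub₀ hq, zpow_natCast, zpow_natCast]
      ring
  have h1 := rothe q (2 * N) (-z * (q ^ N)⁻¹)
  simp only [← hc2] at h1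
  rw [two_mul, Finset.prod_range_add] at h1
  have h2 : ∏ j ∈ Finset.range N, (1 + -z * (q ^ N)⁻¹ * q ^ (N + j)) = fpoch z q N := by
    unfold fpoch
    refine Finset.prod_congr rfl fun j _ => ?_
    rw [pow_add]; field_simp; ring
  have h3 : ∏ j ∈ Finset.range N, (1 + -z * (q ^ N)⁻¹ * q ^ j) = c N * fpoch (q / z) q N := by
    unfold fpoch
    rw [← Finset.prod_range_reflect, hc, ← Finset.prod_mul_distrib]
    refine Finset.prod_congr rfl fun j hj => ?_
    have hj := Finset.mem_range.1 hj
    have : q ^ N = q ^ (N - 1 - j) * q ^ (j + 1) := by rw [← pow_add]; congr 1; omega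
    rw [this]; field_simp; ring
  rw [h2, h3] at h1
  rw [← two_mul] at h1
  apply mul_left_cancel₀ hcn
  rw [Finset.mul_sum]
  rw [show c N * (fpoch z q N * fpoch (q / z) q N) = c N * fpoch (q / z) q N * fpoch z q N by ring, h1]
  refine Finset.sum_congr rfl fun k _ => by ring

lemma eterm_hasDerivAt {q z : ℂ} (hz : z ≠ 0) (m : ℤ) :
    HasDerivAt (fun z => eterm q z m) (m * eterm q z m / z) z := by
  unfold eterm
  have := (hasDerivAt_zpow m z (Or.inl hz)).const_mul ((-1) ^ m * q ^ (m * (m - 1) / 2))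
  have e : m * ((-1) ^ m * q ^ (m * (m - 1) / 2) * z ^ m) / z =
      (-1) ^ m * q ^ (m * (m - 1) / 2) * (m * z ^ (m - 1)) := by
    rw [zpow_sub_one₀ hz]; ring
  rw [e]; exact this

lemma summable_geo (a : ℂ) {q : ℂ} (hq : ‖q‖ < 1) : Summable fun j : ℕ => ‖-(a * q ^ j)‖ := by
  simp only [norm_neg, norm_mul, norm_pow]
  exact (summable_geometric_of_lt_one (norm_nonneg _) hq).mul_left _

lemma fpoch_tendsto (a : ℂ) {q : ℂ} (hq : ‖q‖ < 1) :
    Tendsto (fpoch a q) atTop (𝓝 (qPochhammerInf a q)) := by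
  have := (multipliable_one_add_of_summable (summable_geo a hq)).hasProd.tendsto_prod_nat
  simpa only [← sub_eq_add_neg] using! this

lemma one_sub_ne {x : ℂ} (hx : ‖x‖ < 1) : 1 - x ≠ 0 := by
  intro h
  rw [← sub_eq_zero.1 h] at hx
  simp at hx

lemma qqn_ne {q : ℂ} (hq : ‖q‖ < 1) (j : ℕ) : 1 - q * q ^ j ≠ 0 := by
  apply one_sub_ne
  rw [← pow_succ', norm_pow]
  exact pow_lt_one₀ (norm_nonneg _) hq (by omega)

lemma fpoch_ne {q : ℂ} (hq : ‖q‖ < 1) (n : ℕ) : fpoch q q n ≠ 0 :=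
  Finset.prod_ne_zero_iff.2 fun j _ => qqn_ne hq j

lemma qpoch_ne {q : ℂ} (hq : ‖q‖ < 1) : qPochhammerInf q q ≠ 0 := by
  have := tprod_one_add_ne_zero_of_summable (f := fun j : ℕ => -(q * q ^ j))
    (fun j => by rw [← sub_eq_add_neg]; exact qqn_ne hq j) (summable_geo q hq)
  simpa only [← sub_eq_add_neg] using! this

lemma eterm_summable {q z : ℂ} (hq : ‖q‖ < 1) (hq0 : q ≠ 0) (hz : z ≠ 0) :
    Summable fun m : ℤ => (1 + ‖(m : ℂ)‖) * ‖eterm q z m‖ := by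
  have hpi : (Real.pi : ℂ) ≠ 0 := by exact_mod_cast Real.pi_ne_zero
  set τ : ℂ := Complex.log q / (2 * Real.pi * Complex.I) with hτ
  set w : ℂ := (Complex.log z - Complex.log q / 2) / (2 * Real.pi * Complex.I) with hw
  have hτ' : 2 * Real.pi * Complex.I * τ = Complex.log q := by
    rw [hτ]; field_simp [Complex.I_ne_zero]
  have hw' : 2 * Real.pi * Complex.I * w = Complex.log z - Complex.log q / 2 := by
    rw [hw]; field_simp [Complex.I_ne_zero]
  have him : 0 < τ.im := by
    have h1 := congrArg Complex.re hτ'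
    have h2 : Real.log ‖q‖ < 0 := Real.log_neg (norm_pos_iff.2 hq0) hq
    rw [Complex.log_re] at h1
    simp at h1
    have := Real.pi_pos
    by_contra hc
    push Not at hc
    nlinarith
  have key : ∀ m : ℤ, ‖jacobiTheta₂_term m w τ‖ = ‖eterm q z m‖ := by
    intro m
    have hm : ((m * (m - 1) / 2 : ℤ) : ℂ) = (m : ℂ) * (m - 1) / 2 := by
      have : 2 * (m * (m - 1) / 2) = m * (m - 1) :=
        Int.mul_ediv_cancel' (Int.even_mul_pred_self m).two_dvd
      have h2 : ((2 * (m * (m - 1) / 2) : ℤ) : ℂ) = ((m * (m - 1) : ℤ) : ℂ) := by rw [this]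
      push_cast at h2 ⊢
      linear_combination h2 / 2
    have : eterm q z m = (-1) ^ m * jacobiTheta₂_term m w τ := by
      unfold eterm jacobiTheta₂_term
      rw [mul_assoc]
      congr 1
      conv_lhs => rw [← Complex.exp_log hq0, ← Complex.exp_log hz]
      rw [← Complex.exp_int_mul, ← Complex.exp_int_mul, ← Complex.exp_add, hm]
      congr 1
      linear_combination -(m : ℂ) * hw' - (m : ℂ) ^ 2 / 2 * hτ'
    rw [this, norm_mul, norm_zpow]; simp
  have s1 := ((summable_jacobiTheta₂_term_iff w τ).2 him).norm
  have s2 := (((summable_jacobiTheta₂'_term_iff w τ).2 him).norm).mul_left (2 * Real.pi)⁻¹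
  refine (s1.add s2).congr fun m => ?_
  rw [jacobiTheta₂'_term, norm_mul, key]
  simp [abs_of_pos Real.pi_pos]
  field_simp

lemma qbin_bound {q : ℂ} (hq : ‖q‖ < 1) : ∃ C : ℝ, ∀ n k, ‖qbin q n k‖ ≤ C := by
  obtain ⟨A, hA⟩ := (fpoch_tendsto q hq).norm.bddAbove_range
  obtain ⟨B, hB⟩ := ((fpoch_tendsto q hq).inv₀ (qpoch_ne hq)).norm.bddAbove_range
  have hA' : ∀ n, ‖fpoch q q n‖ ≤ A := fun n => hA ⟨n, rfl⟩
  have hB' : ∀ n, ‖(fpoch q q n)⁻¹‖ ≤ B := fun n => hB ⟨n, rfl⟩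
  have hA0 : 0 ≤ A := (norm_nonneg _).trans (hA' 0)
  have hB0 : 0 ≤ B := (norm_nonneg _).trans (hB' 0)
  refine ⟨A * (B * B), fun n k => ?_⟩
  rcases Nat.lt_or_ge n k with h | h
  · rw [qbin_eq_zero q n k h]; simp; positivity
  · have h1 := qbin_mul q n k h
    have : qbin q n k = fpoch q q n * ((fpoch q q k)⁻¹ * (fpoch q q (n - k))⁻¹) := by
      rw [← h1]
      have := fpoch_ne hq k
      have := fpoch_ne hq (n - k)
      field_simp
    rw [this, norm_mul, norm_mul]
    exact mul_le_mul (hA' _) (mul_le_mul (hB' _) (hB' _) (norm_nonneg _) hB0) (by positivity) hA0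

lemma limit_lemma {q z : ℂ} (hq : ‖q‖ < 1) (hq0 : q ≠ 0) (hz : z ≠ 0) (w : ℤ → ℂ)
    (hw : ∀ m, ‖w m‖ ≤ 1 + ‖(m : ℂ)‖) :
    Tendsto (fun N : ℕ => ∑ k ∈ Finset.range (2 * N + 1),
        qbin q (2 * N) k * (w ((k : ℤ) - N) * eterm q z ((k : ℤ) - N))) atTop
      (𝓝 ((qPochhammerInf q q)⁻¹ * ∑' m : ℤ, w m * eterm q z m)) := by
  obtain ⟨C, hC⟩ := qbin_bound hq
  have hC0 : 0 ≤ C := (norm_nonneg _).trans (hC 0 0)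
  set A : ℕ → ℤ → ℂ := fun N m => if -(N : ℤ) ≤ m then qbin q (2 * N) (m + N).toNat else 0 with hA
  have hsum : ∀ N : ℕ, ∑ k ∈ Finset.range (2 * N + 1),
        qbin q (2 * N) k * (w ((k : ℤ) - N) * eterm q z ((k : ℤ) - N)) =
        ∑' m : ℤ, A N m * (w m * eterm q z m) := by
    intro N
    rw [tsum_eq_sum (s := (Finset.range (2 * N + 1)).image (fun k : ℕ => (k : ℤ) - N))]
    · rw [Finset.sum_image (by intro a _ b _ h; simpa using h)]
      refine Finset.sum_congr rfl fun k _ => ?_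
      simp [hA]
    · intro m hm
      simp only [hA]
      split_ifs with h
      · rw [qbin_eq_zero, zero_mul]
        by_contra hc
        apply hm
        rw [Finset.mem_image]
        exact ⟨(m + N).toNat, by rw [Finset.mem_range]; omega, by omega⟩
      · simp
  simp only [hsum]
  rw [← tsum_mul_left]
  refine tendsto_tsum_of_dominated_convergence ((eterm_summable hq hq0 hz).mul_left C) ?_ ?_
  · intro m
    refine Tendsto.mul_const _ ?_
    have hlim : Tendsto (fun N : ℕ => fpoch q q (2 * N) *
        ((fpoch q q (m + N).toNat)⁻¹ * (fpoch q q ((N : ℤ) - m).toNat)⁻¹)) atTop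
        (𝓝 (qPochhammerInf q q * ((qPochhammerInf q q)⁻¹ * (qPochhammerInf q q)⁻¹))) := by
      have hne := qpoch_ne hq
      have h0 := fpoch_tendsto q hq
      refine (h0.comp ?_).mul (((h0.comp ?_).inv₀ hne).mul ((h0.comp ?_).inv₀ hne))
      · exact tendsto_atTop_atTop.2 fun b => ⟨b, fun a _ => by omega⟩
      · exact tendsto_atTop_atTop.2 fun b => ⟨b + m.natAbs, fun a _ => by omega⟩
      · exact tendsto_atTop_atTop.2 fun b => ⟨b + m.natAbs, fun a _ => by omega⟩
    rw [← mul_assoc, mul_inv_cancel₀ (qpoch_ne hq), one_mul] at hlim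
    refine hlim.congr' ?_
    filter_upwards [eventually_ge_atTop m.natAbs] with N hN
    simp only [hA]
    rw [if_pos (by omega), ← qbin_mul q (2 * N) (m + N).toNat (by omega)]
    rw [show 2 * N - (m + N).toNat = ((N : ℤ) - m).toNat by omega]
    have := fpoch_ne hq (m + N).toNat
    have := fpoch_ne hq ((N : ℤ) - m).toNat
    field_simp
  · refine Eventually.of_forall fun N m => ?_
    rw [norm_mul, norm_mul]
    have : ‖A N m‖ ≤ C := by
      simp only [hA]
      split_ifs
      · exact hC _ _
      · simpa using hC0
    gcongr
    exact hw m

lemma jtp {q z : ℂ} (hq : ‖q‖ < 1) (hq0 : q ≠ 0) (hz : z ≠ 0) :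
    ∑' m : ℤ, eterm q z m =
      qPochhammerInf z q * qPochhammerInf (q / z) q * qPochhammerInf q q := by
  have h1 := limit_lemma hq hq0 hz (fun _ => 1) (fun m => by simp)
  simp only [one_mul, ← finite_jtp hq0 hz] at h1
  have h2 := (fpoch_tendsto z hq).mul (fpoch_tendsto (q / z) hq)
  have h3 := tendsto_nhds_unique h1 h2
  rw [← h3]
  have := qpoch_ne hq
  field_simp

lemma fpoch_hasDerivAt (q : ℂ) (z : ℂ) (h : ∀ j : ℕ, 1 - z * q ^ j ≠ 0) (N : ℕ) :
    HasDerivAt (fun z => fpoch z q N)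
      (fpoch z q N * ∑ j ∈ Finset.range N, (-(q ^ j) / (1 - z * q ^ j))) z := by
  induction N with
  | zero => simpa [fpoch] using hasDerivAt_const z (1 : ℂ)
  | succ n ih =>
    have h1 : HasDerivAt (fun z : ℂ => 1 - z * q ^ n) (-(q ^ n)) z := by
      simpa using ((hasDerivAt_id z).mul_const (q ^ n)).const_sub 1
    have h2 := ih.mul h1
    have e : (fun z => fpoch z q (n + 1)) = (fun z => fpoch z q n) * (fun z : ℂ => 1 - z * q ^ n) := by
      funext y; simp [fpoch_succ]
    rw [e]
    refine h2.congr_deriv ?_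
    rw [Finset.sum_range_succ, fpoch_succ]
    have := h n
    field_simp
    ring

lemma sum_hasDerivAt {q z : ℂ} (hq0 : q ≠ 0) (hz : z ≠ 0) (N : ℕ) :
    HasDerivAt (fun z => fpoch z q N * fpoch (q / z) q N)
      (z⁻¹ * ∑ k ∈ Finset.range (2 * N + 1),
        qbin q (2 * N) k * ((((k : ℤ) - N : ℤ) : ℂ) * eterm q z ((k : ℤ) - N))) z := by
  have h : HasDerivAt (fun z => ∑ k ∈ Finset.range (2 * N + 1),
      qbin q (2 * N) k * eterm q z ((k : ℤ) - N)) (∑ k ∈ Finset.range (2 * N + 1),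
        qbin q (2 * N) k * ((((k : ℤ) - N : ℤ) : ℂ) * eterm q z ((k : ℤ) - N) / z)) z :=
    HasDerivAt.fun_sum fun k _ => (eterm_hasDerivAt hz _).const_mul _
  have h2 := h.congr_of_eventuallyEq (f₁ := fun z => fpoch z q N * fpoch (q / z) q N) (by
    filter_upwards [isOpen_ne.mem_nhds hz] with y hy
    exact finite_jtp hq0 hy N)
  refine h2.congr_deriv ?_
  rw [Finset.mul_sum]
  refine Finset.sum_congr rfl fun k _ => by ring

lemma lambert_summable (a : ℂ) {q : ℂ} (hq : ‖q‖ < 1) :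
    Summable fun j : ℕ => a * q ^ j / (1 - a * q ^ j) := by
  have h0 : Tendsto (fun j : ℕ => (1 - a * q ^ j)⁻¹) atTop (𝓝 ((1 - a * 0)⁻¹)) :=
    (((tendsto_pow_atTop_nhds_zero_of_norm_lt_one hq).const_mul a).const_sub 1).inv₀ (by simp)
  obtain ⟨C, hC⟩ := h0.norm.bddAbove_range
  refine Summable.of_norm_bounded ((summable_geo a hq).mul_right C) fun j => ?_
  rw [div_eq_mul_inv, norm_mul, norm_neg]
  gcongr
  exact hC ⟨j, rfl⟩

lemma jtp_deriv {q z : ℂ} (hq : ‖q‖ < 1) (hq0 : q ≠ 0) (hz : z ≠ 0)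
    (h1 : ∀ j : ℕ, 1 - z * q ^ j ≠ 0) (h2 : ∀ j : ℕ, 1 - q / z * q ^ j ≠ 0) :
    ∑' m : ℤ, (m : ℂ) * eterm q z m =
      qPochhammerInf z q * qPochhammerInf (q / z) q * qPochhammerInf q q *
      ∑' j : ℕ, (q / z * q ^ j / (1 - q / z * q ^ j) - z * q ^ j / (1 - z * q ^ j)) := by
  have hl := limit_lemma hq hq0 hz (fun m => (m : ℂ)) (fun m => by simp)
  have hfin : ∀ N : ℕ, ∑ k ∈ Finset.range (2 * N + 1),
        qbin q (2 * N) k * ((((k : ℤ) - N : ℤ) : ℂ) * eterm q z ((k : ℤ) - N)) =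
      fpoch z q N * fpoch (q / z) q N * ∑ j ∈ Finset.range N,
        (q / z * q ^ j / (1 - q / z * q ^ j) - z * q ^ j / (1 - z * q ^ j)) := by
    intro N
    have d1 := sum_hasDerivAt hq0 hz N
    have d2 : HasDerivAt (fun z => q / z) (-q / z ^ 2) z := by
      have := (hasDerivAt_inv hz).const_mul q
      refine this.congr_deriv ?_
      ring
    have d3 := (fpoch_hasDerivAt q z h1 N).mul ((fpoch_hasDerivAt q (q / z) h2 N).comp z d2)
    have d4 := d1.unique d3
    have d5 : ∑ k ∈ Finset.range (2 * N + 1),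
        qbin q (2 * N) k * ((((k : ℤ) - N : ℤ) : ℂ) * eterm q z ((k : ℤ) - N)) =
        z * (z⁻¹ * ∑ k ∈ Finset.range (2 * N + 1),
        qbin q (2 * N) k * ((((k : ℤ) - N : ℤ) : ℂ) * eterm q z ((k : ℤ) - N))) := by
      field_simp
    rw [d5, d4, Finset.sum_sub_distrib]
    have e1 : ∑ j ∈ Finset.range N, (q / z * q ^ j / (1 - q / z * q ^ j)) =
        -(q / z) * ∑ j ∈ Finset.range N, (-(q ^ j) / (1 - q / z * q ^ j)) := by
      rw [Finset.mul_sum]; exact Finset.sum_congr rfl fun j _ => by ring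
    have e2 : ∑ j ∈ Finset.range N, (z * q ^ j / (1 - z * q ^ j)) =
        -z * ∑ j ∈ Finset.range N, (-(q ^ j) / (1 - z * q ^ j)) := by
      rw [Finset.mul_sum]; exact Finset.sum_congr rfl fun j _ => by ring
    rw [e1, e2]
    simp only [Function.comp]
    generalize ∑ j ∈ Finset.range N, (-(q ^ j) / (1 - q / z * q ^ j)) = X
    generalize ∑ j ∈ Finset.range N, (-(q ^ j) / (1 - z * q ^ j)) = Y
    field_simp
    ring
  simp only [hfin] at hl
  have hs := ((lambert_summable (q / z) hq).sub (lambert_summable z hq)).hasSum.tendsto_sum_nat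
  have h3 := tendsto_nhds_unique hl
    (((fpoch_tendsto z hq).mul (fpoch_tendsto (q / z) hq)).mul hs)
  have := qpoch_ne hq
  rw [mul_right_comm, ← h3]
  field_simp

lemma fpoch_differentiable (q : ℂ) (N : ℕ) : Differentiable ℂ fun z => fpoch z q N := by
  unfold fpoch; fun_prop

lemma fpoch_succ' (z q : ℂ) (N : ℕ) : fpoch z q (N + 1) = (1 - z) * fpoch (z * q) q N := by
  unfold fpoch
  rw [Finset.prod_range_succ', mul_comm]
  simp [pow_succ', mul_assoc]

lemma jacobi_one {q : ℂ} (hq : ‖q‖ < 1) (hq0 : q ≠ 0) :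
    ∑' m : ℤ, (m : ℂ) * eterm q 1 m = - qPochhammerInf q q ^ 3 := by
  have hl := limit_lemma hq hq0 one_ne_zero (fun m => (m : ℂ)) (fun m => by simp)
  rw [← tendsto_add_atTop_iff_nat 1] at hl
  have hfin : ∀ N : ℕ, ∑ k ∈ Finset.range (2 * (N + 1) + 1),
        qbin q (2 * (N + 1)) k * ((((k : ℤ) - (N + 1 : ℕ) : ℤ) : ℂ) * eterm q 1 ((k : ℤ) - (N + 1 : ℕ))) =
      -(fpoch q q N * fpoch q q (N + 1)) := by
    intro N
    have d1 := sum_hasDerivAt hq0 one_ne_zero (N + 1)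
    simp only [fpoch_succ' _ q N] at d1
    simp only [← fpoch_succ' (q / _) q N] at d1
    have d2 : DifferentiableAt ℂ (fun z => fpoch (z * q) q N * fpoch (q / z) q (N + 1)) 1 := by
      refine DifferentiableAt.mul ?_ ?_
      · exact ((fpoch_differentiable q N) _).comp (1 : ℂ) (by fun_prop)
      · exact ((fpoch_differentiable q (N + 1)) _).comp (1 : ℂ) (by fun_prop (disch := simp))
    have d3 := ((hasDerivAt_id (1 : ℂ)).const_sub 1).mul d2.hasDerivAt
    have d4 := d1.unique (d3.congr_of_eventuallyEq (Eventually.of_forall fun z => by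
      simp [fpoch_succ' (q / z) q N]; ring))
    simpa using d4
  simp only [hfin] at hl
  have h3 := tendsto_nhds_unique hl
    ((fpoch_tendsto q hq).mul ((tendsto_add_atTop_iff_nat 1).2 (fpoch_tendsto q hq))).neg
  have := qpoch_ne hq
  field_simp at h3
  rw [h3]

lemma two_half (m : ℤ) : 2 * (m * (m - 1) / 2) = m * (m - 1) :=
  Int.mul_ediv_cancel' (Int.even_mul_pred_self m).two_dvd

lemma eterm_pow {q : ℂ} (hq0 : q ≠ 0) (a n : ℤ) (b : ℤ) (hb : 2 * b = n * (n - 1) + 2 * a * n) :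
    eterm q (q ^ a) n = (-1) ^ n * q ^ b := by
  unfold eterm
  rw [← zpow_mul, mul_assoc, ← zpow_add₀ hq0]
  congr 2
  have := two_half n
  linarith

lemma eterm_summable' {q z : ℂ} (hq : ‖q‖ < 1) (hq0 : q ≠ 0) (hz : z ≠ 0) (w : ℤ → ℂ)
    (hw : ∀ m, ‖w m‖ ≤ 1 + ‖(m : ℂ)‖) : Summable fun m : ℤ => w m * eterm q z m := by
  refine Summable.of_norm_bounded (eterm_summable hq hq0 hz) fun m => ?_
  rw [norm_mul]
  gcongr
  exact hw m

lemma jacobi_two {q : ℂ} (hq : ‖q‖ < 1) (hq0 : q ≠ 0) :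
    ∑' n : ℤ, (2 * n + 1 : ℂ) * eterm q q n = 2 * qPochhammerInf q q ^ 3 := by
  have h := jacobi_one hq hq0
  have e1 : ∀ n : ℤ, ((n + 1 : ℤ) : ℂ) * eterm q 1 (n + 1) = -(((n : ℂ) + 1) * eterm q q n) := by
    intro n
    rw [eterm_succ hq0 one_ne_zero]
    have : eterm q q n = q ^ n * eterm q 1 n := by unfold eterm; simp; ring
    rw [this]; push_cast; ring
  have e2 : ∀ n : ℤ, ((-n : ℤ) : ℂ) * eterm q 1 (-n) = -((n : ℂ) * eterm q q n) := by
    intro n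
    have h1 := eterm_pow hq0 1 n (n * (n - 1) / 2 + n) (by have := two_half n; linarith)
    have h2 := eterm_pow hq0 0 (-n) (n * (n - 1) / 2 + n) (by have := two_half n; linarith)
    rw [zpow_one] at h1
    rw [zpow_zero] at h2
    rw [h1, h2, zpow_neg, ← inv_zpow]
    norm_num
  have h1 := (Equiv.addRight (1 : ℤ)).tsum_eq (fun m : ℤ => (m : ℂ) * eterm q 1 m)
  have h2 := (Equiv.neg ℤ).tsum_eq (fun m : ℤ => (m : ℂ) * eterm q 1 m)
  simp only [Equiv.coe_addRight, e1, h, tsum_neg] at h1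
  simp only [Equiv.neg_apply, e2, h, tsum_neg] at h2
  have s1 : Summable fun n : ℤ => ((n : ℂ) + 1) * eterm q q n :=
    eterm_summable' hq hq0 hq0 _ fun m => (norm_add_le _ _).trans (by simp [add_comm])
  have s2 : Summable fun n : ℤ => (n : ℂ) * eterm q q n :=
    eterm_summable' hq hq0 hq0 _ fun m => by simp
  have : ∀ n : ℤ, (2 * n + 1 : ℂ) * eterm q q n =
      ((n : ℂ) + 1) * eterm q q n + (n : ℂ) * eterm q q n := fun n => by ring
  simp only [this]
  rw [s1.tsum_add s2]
  linear_combination -h1 - h2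

/-- the sum over one residue class -/
noncomputable def resSum (q : ℂ) (k r : ℕ) : ℂ :=
  ∑' m : ℤ, (2 * ((m * k + r : ℤ) : ℂ) + 1) * eterm q q (m * k + r)

lemma tsum_residues {q : ℂ} (hq : ‖q‖ < 1) (hq0 : q ≠ 0) (k : ℕ) (hk : 0 < k) :
    2 * qPochhammerInf q q ^ 3 = ∑ r ∈ Finset.range k, resSum q k r := by
  have : NeZero k := ⟨hk.ne'⟩
  rw [← jacobi_two hq hq0]
  have s : Summable fun n : ℤ => (2 * n + 1 : ℂ) * eterm q q n := by
    have s1 : Summable fun n : ℤ => ((n : ℂ) + 1) * eterm q q n :=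
      eterm_summable' hq hq0 hq0 _ fun m => (norm_add_le _ _).trans (by simp [add_comm])
    have s2 : Summable fun n : ℤ => (n : ℂ) * eterm q q n :=
      eterm_summable' hq hq0 hq0 _ fun m => by simp
    exact (s1.add s2).congr fun n => by ring
  have sdiv := (Int.divModEquiv k).symm.summable_iff.2 s
  rw [← (Int.divModEquiv k).symm.tsum_eq, ← (Equiv.prodComm (Fin k) ℤ).tsum_eq]
  have sprod := (Equiv.prodComm (Fin k) ℤ).summable_iff.2 sdiv
  refine sprod.tsum_prod.trans ?_
  rw [tsum_fintype, Finset.sum_range]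
  rfl

lemma resSum_symm {q : ℂ} (hq0 : q ≠ 0) (k r : ℕ) (h : r < k) :
    resSum q k (k - 1 - r) = resSum q k r := by
  unfold resSum
  rw [← (Equiv.subLeft (-1 : ℤ)).tsum_eq]
  refine tsum_congr fun m => ?_
  simp only [Equiv.subLeft_apply]
  have e : (-1 - m) * (k : ℤ) + ((k - 1 - r : ℕ) : ℤ) = -1 - (m * k + r) := by
    have : ((k - 1 - r : ℕ) : ℤ) = k - 1 - r := by omega
    rw [this]; ring
  rw [e]
  generalize m * (k : ℤ) + r = n
  have h1 := eterm_pow hq0 1 n (n * (n - 1) / 2 + n) (by have := two_half n; linarith)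
  have h2 := eterm_pow hq0 1 (-1 - n) (n * (n - 1) / 2 + n) (by have := two_half n; linarith)
  rw [zpow_one] at h1 h2
  rw [h1, h2, zpow_sub₀ (by norm_num)]
  have : ((-1 : ℂ) ^ n)⁻¹ = (-1) ^ n := by rw [← inv_zpow]; norm_num
  rw [div_eq_mul_inv, this]
  push_cast
  norm_num
  ring

lemma resSum_eq {q : ℂ} (hq0 : q ≠ 0) (k r a : ℕ) (hk : Odd k)
    (ha : 2 * a = k * (k + 1 + 2 * r)) :
    resSum q k r = (-1) ^ r * q ^ (r * (r + 1) / 2) *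
      ∑' m : ℤ, (2 * r + 1 + 2 * k * m : ℂ) * eterm (q ^ (k ^ 2)) (q ^ a) m := by
  unfold resSum
  rw [← tsum_mul_left]
  refine tsum_congr fun m => ?_
  have h0 : r * (r + 1) / 2 * 2 = r * (r + 1) :=
    Nat.div_mul_cancel (Nat.even_mul_succ_self r).two_dvd
  have h0' : ((r * (r + 1) / 2 : ℕ) : ℤ) * 2 = r * (r + 1) := by exact_mod_cast h0
  have ha' : (2 : ℤ) * a = k * (k + 1 + 2 * r) := by exact_mod_cast ha
  have hm := two_half m
  have h1 := eterm_pow hq0 1 (m * k + r)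
    (((r * (r + 1) / 2 : ℕ) : ℤ) + ((k ^ 2 : ℕ) : ℤ) * (m * (m - 1) / 2) + a * m) (by
      push_cast at h0' ⊢
      linear_combination h0' + (k : ℤ) ^ 2 * hm + m * ha')
  rw [zpow_one] at h1
  have hs : (-1 : ℂ) ^ (m * k + r : ℤ) = (-1) ^ r * (-1) ^ m := by
    rw [zpow_add₀ (by norm_num), mul_comm m, zpow_mul, zpow_natCast, zpow_natCast, hk.neg_one_pow,
      mul_comm]
  rw [h1, hs]
  unfold eterm
  rw [zpow_add₀ hq0, zpow_add₀ hq0, zpow_natCast, zpow_mul, zpow_mul, zpow_natCast, zpow_natCast]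
  push_cast
  ring

lemma resSum_mid {q : ℂ} (hq : ‖q‖ < 1) (hq0 : q ≠ 0) (k s : ℕ) (hk : k = 2 * s + 1) :
    resSum q k s = 2 * ((-1) ^ s * k * q ^ ((k ^ 2 - 1) / 8) *
      qPochhammerInf (q ^ (k ^ 2)) (q ^ (k ^ 2)) ^ 3) := by
  have hQ : ‖q ^ (k ^ 2)‖ < 1 := by
    rw [norm_pow]; exact pow_lt_one₀ (norm_nonneg _) hq (by subst hk; positivity)
  rw [resSum_eq hq0 k s (k ^ 2) ⟨s, hk⟩ (by subst hk; ring)]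
  have e : ∀ m : ℤ, (2 * s + 1 + 2 * k * m : ℂ) * eterm (q ^ (k ^ 2)) (q ^ (k ^ 2)) m =
      k * ((2 * m + 1 : ℂ) * eterm (q ^ (k ^ 2)) (q ^ (k ^ 2)) m) := by
    intro m
    rw [hk]; push_cast; ring
  simp only [e]
  rw [tsum_mul_left, jacobi_two hQ (pow_ne_zero _ hq0)]
  have : (k ^ 2 - 1) / 8 = s * (s + 1) / 2 := by
    have : k ^ 2 - 1 = 4 * (s * (s + 1)) := by
      rw [hk, show (2 * s + 1) ^ 2 = 4 * (s * (s + 1)) + 1 by ring]; rfl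
    rw [this]; omega
  rw [this]; ring

lemma resSum_main {q : ℂ} (hq : ‖q‖ < 1) (hq0 : q ≠ 0) (k s l : ℕ) (hk : k = 2 * s + 1)
    (hl : l < s) :
    resSum q k l = (-1 : ℂ) ^ l * q ^ (l * (l + 1) / 2) *
          (qPochhammerInf (q ^ (k * (k - 1 - 2 * l) / 2)) (q ^ (k ^ 2)) *
            qPochhammerInf (q ^ (k * (k + 1 + 2 * l) / 2)) (q ^ (k ^ 2)) *
            qPochhammerInf (q ^ (k ^ 2)) (q ^ (k ^ 2))) *
          ((2 * l + 1 : ℕ) + 2 * (k : ℂ) *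
            ∑' n : ℕ,
              (q ^ (k ^ 2 * n + k * (k - 1 - 2 * l) / 2) /
                  (1 - q ^ (k ^ 2 * n + k * (k - 1 - 2 * l) / 2)) -
                q ^ (k ^ 2 * n + k * (k + 1 + 2 * l) / 2) /
                  (1 - q ^ (k ^ 2 * n + k * (k + 1 + 2 * l) / 2)))) := by
  have hkp : 0 < k := by omega
  have hQ : ‖q ^ (k ^ 2)‖ < 1 := by
    rw [norm_pow]; exact pow_lt_one₀ (norm_nonneg _) hq (by positivity)
  have ea : k * (k + 1 + 2 * l) / 2 = k * (s + 1 + l) := by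
    rw [show k * (k + 1 + 2 * l) = 2 * (k * (s + 1 + l)) by rw [hk]; ring]; omega
  have eb : k * (k - 1 - 2 * l) / 2 = k * (s - l) := by
    rw [show k - 1 - 2 * l = 2 * (s - l) by omega,
      show k * (2 * (s - l)) = 2 * (k * (s - l)) by ring]; omega
  rw [ea, eb]
  set a := k * (s + 1 + l) with ha
  set b := k * (s - l) with hb
  have hab : a + b = k ^ 2 := by
    rw [ha, hb, ← mul_add, show s + 1 + l + (s - l) = k by omega]; ring
  have hbp : 0 < b := Nat.mul_pos hkp (by omega)
  have hap : 0 < a := Nat.mul_pos hkp (by omega)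
  rw [resSum_eq hq0 k l a ⟨s, hk⟩ (by rw [ha, hk]; ring)]
  have hz : q ^ a ≠ 0 := pow_ne_zero _ hq0
  have hdiv : q ^ (k ^ 2) / q ^ a = q ^ b := by
    rw [← hab, pow_add]; field_simp
  have hne : ∀ c : ℕ, 0 < c → ∀ j : ℕ, 1 - q ^ c * (q ^ (k ^ 2)) ^ j ≠ 0 := by
    intro c hc j
    rw [← pow_mul, ← pow_add]
    apply one_sub_ne
    rw [norm_pow]; exact pow_lt_one₀ (norm_nonneg _) hq (by omega)
  have h1 := jtp hQ (pow_ne_zero _ hq0) hz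
  have h2 := jtp_deriv hQ (pow_ne_zero _ hq0) hz (hne a hap) (by rw [hdiv]; exact hne b hbp)
  rw [hdiv] at h1 h2
  have s1 : Summable fun m : ℤ => eterm (q ^ (k ^ 2)) (q ^ a) m := by
    simpa using eterm_summable' hQ (pow_ne_zero _ hq0) hz (fun _ => 1) fun m => by simp
  have s2 : Summable fun m : ℤ => (m : ℂ) * eterm (q ^ (k ^ 2)) (q ^ a) m :=
    eterm_summable' hQ (pow_ne_zero _ hq0) hz _ fun m => by simp
  have e : ∀ m : ℤ, (2 * l + 1 + 2 * k * m : ℂ) * eterm (q ^ (k ^ 2)) (q ^ a) m =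
      (2 * l + 1) * eterm (q ^ (k ^ 2)) (q ^ a) m +
      2 * k * ((m : ℂ) * eterm (q ^ (k ^ 2)) (q ^ a) m) := fun m => by ring
  simp only [e]
  rw [(s1.mul_left _).tsum_add (s2.mul_left _), tsum_mul_left, tsum_mul_left, h1, h2]
  have e3 : ∀ c n : ℕ, q ^ (k ^ 2 * n + c) = q ^ c * (q ^ (k ^ 2)) ^ n := by
    intro c n; rw [pow_add, pow_mul, mul_comm]
  simp only [e3]
  push_cast
  ring

lemma qpoch_zero (q : ℂ) : qPochhammerInf 0 q = 1 := by simp [qPochhammerInf]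

lemma sum_symm (f : ℕ → ℂ) (s : ℕ) (hf : ∀ r < 2 * s + 1, f (2 * s + 1 - 1 - r) = f r) :
    ∑ r ∈ Finset.range (2 * s + 1), f r = 2 * ∑ r ∈ Finset.range s, f r + f s := by
  rw [show 2 * s + 1 = (s + 1) + s by ring, Finset.sum_range_add, Finset.sum_range_succ]
  have : ∑ x ∈ Finset.range s, f (s + 1 + x) = ∑ r ∈ Finset.range s, f r := by
    rw [← Finset.sum_range_reflect]
    refine Finset.sum_congr rfl fun j hj => ?_
    have hj := Finset.mem_range.1 hj
    rw [← hf j (by omega)]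
    congr 1
    omega
  rw [this]; ring


/-- the main identity for `(q;q)_∞³` when `k` is a positive odd integer. -/
theorem cube_eta_identity_odd (k : ℕ) (hk : 0 < k) (hko : Odd k)
    (q : ℂ) (hq : ‖q‖ < 1) :
    (qPochhammerInf q q) ^ 3 -
        (-1 : ℂ) ^ ((k - 1) / 2) * (k : ℂ) * q ^ ((k ^ 2 - 1) / 8) *
          (qPochhammerInf (q ^ (k ^ 2)) (q ^ (k ^ 2))) ^ 3 =
      ∑ l ∈ Finset.range ((k - 1) / 2),
        (-1 : ℂ) ^ l * q ^ (l * (l + 1) / 2) *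
          (qPochhammerInf (q ^ (k * (k - 1 - 2 * l) / 2)) (q ^ (k ^ 2)) *
            qPochhammerInf (q ^ (k * (k + 1 + 2 * l) / 2)) (q ^ (k ^ 2)) *
            qPochhammerInf (q ^ (k ^ 2)) (q ^ (k ^ 2))) *
          ((2 * l + 1 : ℕ) + 2 * (k : ℂ) *
            ∑' n : ℕ,
              (q ^ (k ^ 2 * n + k * (k - 1 - 2 * l) / 2) /
                  (1 - q ^ (k ^ 2 * n + k * (k - 1 - 2 * l) / 2)) -
                q ^ (k ^ 2 * n + k * (k + 1 + 2 * l) / 2) /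
                  (1 - q ^ (k ^ 2 * n + k * (k + 1 + 2 * l) / 2)))) := by
  obtain ⟨s, hs⟩ := hko
  have hs2 : (k - 1) / 2 = s := by omega
  rw [hs2]
  by_cases hq0 : q = 0
  · subst hq0
    rcases Nat.eq_zero_or_pos s with h | h
    · subst h
      subst hs
      simp
    · have hk3 : 3 ≤ k := by omega
      have e1 : (k ^ 2 - 1) / 8 ≠ 0 := by
        have : 9 ≤ k ^ 2 := by nlinarith
        omega
      have e2 : k ^ 2 ≠ 0 := by positivity
      have e0 : ∀ c, 0 < k * c → k * (2 * c) / 2 ≠ 0 := by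
        intro c hc
        rw [show k * (2 * c) = 2 * (k * c) by ring]; omega
      rw [Finset.sum_eq_single_of_mem 0 (Finset.mem_range.2 h)]
      · have e3 : k * (k - 1 - 2 * 0) / 2 ≠ 0 := by
          rw [show k - 1 - 2 * 0 = 2 * s by omega]
          exact e0 s (Nat.mul_pos hk h)
        have e4 : k * (k + 1 + 2 * 0) / 2 ≠ 0 := by
          rw [show k + 1 + 2 * 0 = 2 * (s + 1) by omega]
          exact e0 (s + 1) (Nat.mul_pos hk (by omega))
        have e5 : ∀ n, k ^ 2 * n + k * (k - 1 - 2 * 0) / 2 ≠ 0 := fun n => by omega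
        have e6 : ∀ n, k ^ 2 * n + k * (k + 1 + 2 * 0) / 2 ≠ 0 := fun n => by omega
        simp only [zero_pow e1, zero_pow e2, zero_pow e3, zero_pow e4, zero_pow (e5 _),
          zero_pow (e6 _), qpoch_zero]
        simp
      · intro l _ hl
        have : l * (l + 1) / 2 ≠ 0 := by
          have : 1 ≤ l := by omega
          have : 2 ≤ l * (l + 1) := by nlinarith
          omega
        rw [zero_pow this]; simp
  · have h1 := tsum_residues hq hq0 k hk
    have h2 := sum_symm (resSum q k) s (fun r hr => by
      have := resSum_symm hq0 k r (by omega)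
      rwa [hs] at this ⊢)
    rw [← hs] at h2
    rw [h2, resSum_mid hq hq0 k s hs] at h1
    rw [← Finset.sum_congr rfl fun l hl =>
      resSum_main hq hq0 k s l hs (Finset.mem_range.1 hl)]
    linear_combination h1 / 2
end

section
/- For every complex number q with ‖q‖ < 1, ( Σ_{n∈ℤ} q^{n²} )² = 1 + 4·Σ_{n≥0} ( q^{4n+1}/(1 − q^{4n+1}) − q^{4n+3}/(1 − q^{4n+3}) ). -/
namespace TwoSq

/-- representations of `n` as Gaussian norm -/
def S (n : ℕ) : Set GaussianInt := {z | z.norm = n}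

lemma S_finite (n : ℕ) : (S n).Finite := by
  have hinj : Function.Injective (fun z : GaussianInt => (z.re, z.im)) := by
    intro z w h
    simp only [Prod.mk.injEq] at h
    exact Zsqrtd.ext h.1 h.2
  refine Set.Finite.subset (Set.Finite.preimage hinj.injOn
    ((Set.finite_Icc (-(n:ℤ)) n).prod (Set.finite_Icc (-(n:ℤ)) n))) ?_
  intro z hz
  have h : z.norm = n := hz
  rw [Zsqrtd.norm_def] at h
  simp only [Set.mem_preimage, Set.mem_prod, Set.mem_Icc]
  refine ⟨⟨?_, ?_⟩, ⟨?_, ?_⟩⟩ <;> nlinarith [mul_self_nonneg z.re, mul_self_nonneg z.im, mul_self_nonneg (z.re - 1), mul_self_nonneg (z.im-1), mul_self_nonneg (z.re + 1), mul_self_nonneg (z.im+1), Int.le_self_sq z.re, Int.le_self_sq z.im, Int.le_self_sq (-z.re), Int.le_self_sq (-z.im)]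

noncomputable def N (n : ℕ) : ℕ := (S n).ncard

lemma ncard_dvd (g : GaussianInt) (m n : ℕ) (hm : 0 < m) (hg : g.norm = m) :
    {z ∈ S (m * n) | g ∣ z}.ncard = N n := by
  have hg0 : g ≠ 0 := by
    rintro rfl
    simp at hg
    omega
  have : {z ∈ S (m * n) | g ∣ z} = (fun w => g * w) '' S n := by
    ext z
    constructor
    · rintro ⟨hz, w, rfl⟩
      refine ⟨w, ?_, rfl⟩
      have h : (g * w).norm = ((m * n : ℕ) : ℤ) := hz
      rw [Zsqrtd.norm_mul, hg] at h
      push_cast at h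
      exact mul_left_cancel₀ (by exact_mod_cast hm.ne') h
    · rintro ⟨w, hw, rfl⟩
      have h : w.norm = n := hw
      refine ⟨?_, dvd_mul_right _ _⟩
      change (g * w).norm = ((m * n : ℕ) : ℤ)
      rw [Zsqrtd.norm_mul, hg, h]; push_cast; rfl
  rw [this, Set.ncard_image_of_injective _ (mul_right_injective₀ hg0)]; rfl

lemma norm_natCast' (p : ℕ) : ((p : GaussianInt)).norm = ((p * p : ℕ) : ℤ) := by
  simp [Zsqrtd.norm_natCast]

lemma ncard_dvd_p (p n : ℕ) (hp : 0 < p) :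
    {z ∈ S (p * n) | (p : GaussianInt) ∣ z}.ncard = if p ∣ n then N (n / p) else 0 := by
  split_ifs with h
  · obtain ⟨k, rfl⟩ := h
    rw [Nat.mul_div_cancel_left _ hp, ← mul_assoc]
    exact ncard_dvd _ _ _ (Nat.mul_pos hp hp) (norm_natCast' p)
  · rw [Set.ncard_eq_zero ((S_finite _).subset (Set.sep_subset _ _))]
    ext z
    simp only [Set.mem_ofPred_eq, Set.mem_empty_iff_false, iff_false]
    rintro ⟨hz, w, rfl⟩
    have hz : ((p : GaussianInt) * w).norm = ((p * n : ℕ) : ℤ) := hz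
    rw [Zsqrtd.norm_mul, norm_natCast'] at hz
    push_cast at hz
    rw [mul_assoc] at hz
    have := mul_left_cancel₀ (by exact_mod_cast hp.ne') hz
    apply h
    have h' : (p : ℤ) ∣ n := ⟨_, this.symm⟩
    exact Int.natCast_dvd_natCast.mp h'

lemma dvd_star_iff (g z : GaussianInt) : g ∣ star z ↔ star g ∣ z := by
  constructor
  · rintro ⟨w, h⟩
    exact ⟨star w, by rw [← star_star z, h, star_mul']⟩
  · rintro ⟨w, rfl⟩
    exact ⟨star w, by rw [star_mul', star_star]⟩

lemma p_dvd_mul_star (p n : ℕ) (z : GaussianInt) (hz : z ∈ S (p * n)) :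
    (p : GaussianInt) ∣ z * star z := by
  have h : z.norm = ((p * n : ℕ) : ℤ) := hz
  have := Zsqrtd.norm_eq_mul_conj z
  rw [← this, h]
  exact ⟨n, by push_cast; rfl⟩

lemma N_three (p n : ℕ) (hp : p.Prime) (h3 : p % 4 = 3) :
    N (p * n) = if p ∣ n then N (n / p) else 0 := by
  rw [← ncard_dvd_p p n hp.pos, N]
  congr 1
  ext z
  simp only [Set.mem_ofPred_eq, iff_self_and]
  intro hz
  have := Fact.mk hp
  rcases (GaussianInt.prime_of_nat_prime_of_mod_four_eq_three p h3).dvd_or_dvd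
    (p_dvd_mul_star p n z hz) with h | h
  · exact h
  · rw [dvd_star_iff] at h
    simpa using h

lemma prime_of_norm (p : ℕ) (hp : p.Prime) (g : GaussianInt) (hg : g.norm = p) : Prime g := by
  apply Irreducible.prime
  constructor
  · intro h
    rw [← Zsqrtd.norm_eq_one_iff, hg] at h
    simp at h
    exact hp.one_lt.ne' h
  · intro a b hab
    rw [← Zsqrtd.norm_eq_one_iff, ← Zsqrtd.norm_eq_one_iff]
    have : p = a.norm.natAbs * b.norm.natAbs := by
      rw [← Int.natAbs_mul, ← Zsqrtd.norm_mul, ← hab, hg]; simp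
    rw [this, Nat.prime_mul_iff] at hp
    tauto

lemma exists_norm (p : ℕ) (hp : p.Prime) (h3 : p % 4 ≠ 3) : ∃ g : GaussianInt, g.norm = p := by
  have := Fact.mk hp
  obtain ⟨a, b, h⟩ := Nat.Prime.sq_add_sq h3
  refine ⟨⟨a, b⟩, ?_⟩
  rw [Zsqrtd.norm_def, ← h]; push_cast; ring

lemma norm_star (g : GaussianInt) : (star g).norm = g.norm := by
  simp [Zsqrtd.norm_def]

lemma g_dvd (p n : ℕ) (hp : p.Prime) (g : GaussianInt) (hg : g.norm = p) (z : GaussianInt)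
    (hz : z ∈ S (p * n)) : g ∣ z ∨ star g ∣ z := by
  rw [← dvd_star_iff]
  apply (prime_of_norm p hp g hg).dvd_or_dvd
  refine dvd_trans ?_ (p_dvd_mul_star p n z hz)
  exact ⟨star g, by rw [← Zsqrtd.norm_eq_mul_conj, hg]; simp⟩

lemma N_two (n : ℕ) : N (2 * n) = N n := by
  have hg : (⟨1, 1⟩ : GaussianInt).norm = (2 : ℕ) := by simp [Zsqrtd.norm_def]
  rw [← ncard_dvd ⟨1, 1⟩ 2 n (by norm_num) hg, N]
  congr 1
  ext z
  simp only [Set.mem_ofPred_eq, iff_self_and]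
  intro hz
  rcases g_dvd 2 n Nat.prime_two _ hg z hz with h | h
  · exact h
  · refine dvd_trans ?_ h
    exact ⟨⟨0, -1⟩, by ext <;> simp⟩

lemma N_one (p n : ℕ) (hp : p.Prime) (h1 : p % 4 = 1) :
    N (p * n) + (if p ∣ n then N (n / p) else 0) = 2 * N n := by
  obtain ⟨g, hg⟩ := exists_norm p hp (by omega)
  have hg' : (star g).norm = p := by rw [norm_star, hg]
  have hpg : (p : GaussianInt) = g * star g := by rw [← Zsqrtd.norm_eq_mul_conj, hg]; simp
  rw [← ncard_dvd_p p n hp.pos, two_mul]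
  nth_rw 2 [← ncard_dvd g p n hp.pos hg]
  rw [← ncard_dvd (star g) p n hp.pos hg']
  rw [← Set.ncard_union_add_ncard_inter _ _ ((S_finite _).subset (Set.sep_subset _ _))
    ((S_finite _).subset (Set.sep_subset _ _)), N]
  congr 2
  · ext z
    simp only [Set.mem_union, Set.mem_ofPred_eq]
    have := g_dvd p n hp g hg z
    tauto
  · ext z
    simp only [Set.mem_inter_iff, Set.mem_ofPred_eq]
    constructor
    · rintro ⟨hz, h⟩
      rw [hpg] at h
      exact ⟨⟨hz, dvd_of_mul_left_dvd h⟩, hz, dvd_of_mul_right_dvd h⟩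
    · rintro ⟨⟨hz, h⟩, -, w, rfl⟩
      refine ⟨hz, ?_⟩
      rw [hpg]
      apply mul_dvd_mul_left
      refine ((prime_of_norm p hp _ hg').dvd_or_dvd h).resolve_left ?_
      intro hd
      have h2 : star g ∣ g + star g := dvd_add hd dvd_rfl
      have h3 : g + star g = ((2 * g.re : ℤ) : GaussianInt) := by
        ext <;> simp; ring
      rw [h3] at h2
      obtain ⟨w, h2⟩ := h2
      have h4 := congrArg Zsqrtd.norm h2
      rw [Zsqrtd.norm_mul, hg', Zsqrtd.norm_intCast] at h4
      have hpZ : Prime (p : ℤ) := Nat.prime_iff_prime_int.mp hp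
      have h5 : (p : ℤ) ∣ (2 * g.re) * (2 * g.re) := ⟨_, h4⟩
      have h6 : (p : ℤ) ∣ 2 * g.re := by
        rcases hpZ.dvd_or_dvd h5 with h | h <;> exact h
      have h7 : (p : ℤ) ∣ g.re := by
        refine (hpZ.dvd_or_dvd h6).resolve_left ?_
        intro h
        have h : p ∣ 2 := by exact_mod_cast h
        have := (Nat.prime_dvd_prime_iff_eq hp Nat.prime_two).mp h
        omega
      rw [Zsqrtd.norm_def] at hg
      have h8 : (p : ℤ) ∣ g.im := by
        have : (p : ℤ) ∣ g.im * g.im := by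
          have : g.im * g.im = p - g.re * g.re := by linarith
          rw [this]
          exact dvd_sub dvd_rfl (h7.mul_right _)
        rcases hpZ.dvd_or_dvd this with h | h <;> exact h
      obtain ⟨a, ha⟩ := h7
      obtain ⟨b, hb⟩ := h8
      have h9 : (p : ℤ) * (p * (a * a + b * b)) = p * 1 := by
        rw [ha, hb] at hg; linarith
      have h10 := mul_left_cancel₀ hpZ.ne_zero h9
      exact hpZ.not_isUnit (IsUnit.of_mul_eq_one _ h10)

def R (n : ℕ) : ℤ := ∑ d ∈ n.divisors, ZMod.χ₄ (d : ZMod 4)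

lemma R_rec (p n : ℕ) (hp : p.Prime) (hn : n ≠ 0) :
    R (p * n) + ZMod.χ₄ (p : ZMod 4) * (if p ∣ n then R (n / p) else 0)
      = (1 + ZMod.χ₄ (p : ZMod 4)) * R n := by
  classical
  have hinj : Function.Injective (fun d : ℕ => p * d) := mul_right_injective₀ hp.ne_zero
  have key : ∀ m, ZMod.χ₄ (p : ZMod 4) * R m =
      ∑ d ∈ m.divisors.image (fun d => p * d), ZMod.χ₄ (d : ZMod 4) := by
    intro m
    rw [Finset.sum_image hinj.injOn, R, Finset.mul_sum]
    refine Finset.sum_congr rfl fun d _ => ?_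
    rw [Nat.cast_mul, map_mul]
  have hu : (p * n).divisors = n.divisors ∪ n.divisors.image (fun d => p * d) := by
    ext d
    simp only [Nat.mem_divisors, Finset.mem_union, Finset.mem_image]
    constructor
    · rintro ⟨h, h0⟩
      by_cases hd : p ∣ d
      · obtain ⟨e, rfl⟩ := hd
        exact Or.inr ⟨e, ⟨Nat.dvd_of_mul_dvd_mul_left hp.pos h, hn⟩, rfl⟩
      · exact Or.inl ⟨(((Nat.Prime.coprime_iff_not_dvd hp).mpr hd).symm).dvd_of_dvd_mul_left h, hn⟩
    · rintro (⟨h, -⟩ | ⟨e, ⟨h, -⟩, rfl⟩)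
      · exact ⟨h.mul_left _, mul_ne_zero hp.ne_zero hn⟩
      · exact ⟨mul_dvd_mul_left _ h, mul_ne_zero hp.ne_zero hn⟩
  have hi : ZMod.χ₄ (p : ZMod 4) * (if p ∣ n then R (n / p) else 0) =
      ∑ d ∈ n.divisors ∩ n.divisors.image (fun d => p * d), ZMod.χ₄ (d : ZMod 4) := by
    split_ifs with h
    · rw [key]
      apply Finset.sum_congr _ (fun _ _ => rfl)
      obtain ⟨k, rfl⟩ := h
      have hk : k ≠ 0 := by rintro rfl; simp at hn
      rw [Nat.mul_div_cancel_left _ hp.pos]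
      ext d
      simp only [Nat.mem_divisors, Finset.mem_inter, Finset.mem_image]
      constructor
      · rintro ⟨e, ⟨h, -⟩, rfl⟩
        exact ⟨⟨mul_dvd_mul_left _ h, hn⟩, e, ⟨h.mul_left _, hn⟩, rfl⟩
      · rintro ⟨⟨h, -⟩, e, -, rfl⟩
        exact ⟨e, ⟨Nat.dvd_of_mul_dvd_mul_left hp.pos h, hk⟩, rfl⟩
    · rw [mul_zero]
      symm
      apply Finset.sum_eq_zero
      intro d hd
      simp only [Nat.mem_divisors, Finset.mem_inter, Finset.mem_image] at hd
      obtain ⟨⟨h1, -⟩, e, -, rfl⟩ := hd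
      exact absurd (dvd_of_mul_right_dvd h1) h
  rw [hi, add_mul, one_mul, key n, R, hu, Finset.sum_union_inter, R]

lemma N_base : N 1 = 4 := by
  have : S 1 = {⟨1, 0⟩, ⟨-1, 0⟩, ⟨0, 1⟩, ⟨0, -1⟩} := by
    ext z
    simp only [S, Set.mem_ofPred_eq, Set.mem_insert_iff, Set.mem_singleton_iff, Zsqrtd.ext_iff,
      Zsqrtd.norm_def]
    constructor
    · intro h
      have h1 : z.re ≤ 1 := by push_cast at h; nlinarith [mul_self_nonneg z.im]
      have h2 : -1 ≤ z.re := by push_cast at h; nlinarith [mul_self_nonneg z.im]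
      have h3 : z.im ≤ 1 := by push_cast at h; nlinarith [mul_self_nonneg z.re]
      have h4 : -1 ≤ z.im := by push_cast at h; nlinarith [mul_self_nonneg z.re]
      generalize z.re = a at *
      generalize z.im = b at *
      interval_cases a <;> interval_cases b <;> simp_all
    · rintro (⟨h, h'⟩ | ⟨h, h'⟩ | ⟨h, h'⟩ | ⟨h, h'⟩) <;> simp [h, h']
  rw [N, this]
  have : ({⟨1, 0⟩, ⟨-1, 0⟩, ⟨0, 1⟩, ⟨0, -1⟩} : Set GaussianInt)
    = (({⟨1, 0⟩, ⟨-1, 0⟩, ⟨0, 1⟩, ⟨0, -1⟩} : Finset GaussianInt) : Set GaussianInt) := by simp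
  rw [this, Set.ncard_coe_finset]
  decide

lemma N_zero : N 0 = 1 := by
  have : S 0 = {0} := by
    ext z
    simp only [S, Set.mem_ofPred_eq, Set.mem_singleton_iff]
    exact_mod_cast GaussianInt.norm_eq_zero
  rw [N, this, Set.ncard_singleton]

lemma N_eq (n : ℕ) (hn : n ≠ 0) : (N n : ℤ) = 4 * R n := by
  induction n using Nat.strong_induction_on with
  | _ n ih =>
  by_cases h1 : n = 1
  · subst h1
    rw [N_base]; simp [R]
  · obtain ⟨p, hp, m, rfl⟩ := Nat.exists_prime_and_dvd h1
    have hm : m ≠ 0 := by rintro rfl; simp at hn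
    have ihm := ih m (by nlinarith [hp.two_le, Nat.pos_of_ne_zero hm]) hm
    have hrec := R_rec p m hp hm
    have ih2 : (((if p ∣ m then N (m / p) else 0 : ℕ)) : ℤ) =
        4 * (if p ∣ m then R (m / p) else 0) := by
      split_ifs with h
      · obtain ⟨k, rfl⟩ := h
        have hk : k ≠ 0 := by rintro rfl; simp at hm
        rw [Nat.mul_div_cancel_left _ hp.pos]
        have hk' := Nat.pos_of_ne_zero hk
        apply ih k _ hk
        have h2 := hp.two_le
        calc k < p * k := by nlinarith
          _ ≤ p * (p * k) := Nat.le_mul_of_pos_left _ hp.pos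
      · simp
    rcases hp.eq_two_or_odd with rfl | hodd
    · rw [N_two, ihm]
      have : ZMod.χ₄ ((2 : ℕ) : ZMod 4) = 0 := by decide
      rw [this] at hrec
      linarith
    · have : p % 4 = 1 ∨ p % 4 = 3 := by omega
      rcases this with h | h
      · have h' := N_one p m hp h
        rw [ZMod.χ₄_nat_one_mod_four h] at hrec
        have h' := congrArg (Nat.cast : ℕ → ℤ) h'
        rw [Nat.cast_add, ih2, Nat.cast_mul, ihm] at h'
        push_cast at h'
        linarith
      · rw [ZMod.χ₄_nat_three_mod_four h] at hrec
        rw [N_three p m hp h, ih2]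
        linarith

lemma summable_theta (q : ℂ) (hq : ‖q‖ < 1) :
    Summable fun n : ℤ => ‖q ^ (n.natAbs ^ 2)‖ := by
  have hb : Summable fun n : ℕ => ‖q ^ (n ^ 2)‖ := by
    refine Summable.of_nonneg_of_le (fun _ => norm_nonneg _) (fun n => ?_)
      (summable_geometric_of_lt_one (norm_nonneg q) hq)
    rw [norm_pow]
    exact pow_le_pow_of_le_one (norm_nonneg q) hq.le (Nat.le_self_pow two_ne_zero n)
  refine Summable.of_nat_of_neg ?_ ?_
  · simpa using hb
  · simpa using hb

lemma theta_sq (q : ℂ) (hq : ‖q‖ < 1) :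
    HasSum (fun n : ℕ => (N n : ℂ) * q ^ n) ((∑' n : ℤ, q ^ (n.natAbs ^ 2)) ^ 2) := by
  have hs := summable_theta q hq
  have h1 := (summable_mul_of_summable_norm hs hs).hasSum
  rw [← tsum_mul_tsum_of_summable_norm hs hs, ← sq] at h1
  have h2 := h1.tsum_fiberwise (fun z : ℤ × ℤ => z.1.natAbs ^ 2 + z.2.natAbs ^ 2)
  refine (congrArg (fun F : ℕ → ℂ => HasSum F _) (funext fun n => ?_)).mpr h2
  have h3 : ∀ b : ((fun z : ℤ × ℤ => z.1.natAbs ^ 2 + z.2.natAbs ^ 2) ⁻¹' {n}),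
      q ^ (b.1.1.natAbs ^ 2) * q ^ (b.1.2.natAbs ^ 2) = q ^ n := by
    rintro ⟨b, hb⟩
    rw [← pow_add]
    congr 1
  rw [tsum_congr h3, tsum_const, nsmul_eq_mul]
  congr 2
  rw [N, ← Nat.card_coe_set_eq]
  refine Nat.card_congr ⟨fun z => ⟨(z.1.re, z.1.im), ?_⟩, fun z => ⟨⟨z.1.1, z.1.2⟩, ?_⟩, ?_, ?_⟩
  · have h : z.1.norm = n := z.2
    rw [Zsqrtd.norm_def] at h
    simp only [Set.mem_preimage, Set.mem_singleton_iff]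
    zify
    rw [sq_abs, sq_abs]
    linarith
  · have h : z.1.1.natAbs ^ 2 + z.1.2.natAbs ^ 2 = n := z.2
    zify at h
    rw [sq_abs, sq_abs] at h
    change Zsqrtd.norm _ = _
    rw [Zsqrtd.norm_def]
    linarith
  · intro z; rfl
  · intro z; rfl

/-- the character, complex valued -/
noncomputable def ch (n : ℕ) : ℂ := ((ZMod.χ₄ (n : ZMod 4) : ℤ) : ℂ)

lemma ch_norm (n : ℕ) : ‖ch n‖ ≤ 1 := by
  rw [ch]
  rcases ZMod.isQuadratic_χ₄ (n : ZMod 4) with h | h | h <;> rw [h] <;> simp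

lemma summable_lam (q : ℂ) (hq : ‖q‖ < 1) :
    Summable fun c : ℕ+ × ℕ+ => ch c.1 * q ^ (c.1 * c.2 : ℕ) := by
  refine Summable.of_norm_bounded (summable_prod_mul_pow 0 hq).norm fun c => ?_
  rw [norm_mul, pow_zero, one_mul]
  exact mul_le_of_le_one_left (norm_nonneg _) (ch_norm _)

lemma lam_R (q : ℂ) (hq : ‖q‖ < 1) :
    ∑' c : ℕ+ × ℕ+, ch c.1 * q ^ (c.1 * c.2 : ℕ) = ∑' n : ℕ+, (R n : ℂ) * q ^ (n : ℕ) := by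
  have hs := sigmaAntidiagonalEquivProd.summable_iff.mpr (summable_lam q hq)
  rw [← sigmaAntidiagonalEquivProd.tsum_eq]
  refine (Summable.tsum_sigma hs).trans ?_
  refine tsum_congr fun n => ?_
  simp only [Function.comp_apply, sigmaAntidiagonalEquivProd, divisorsAntidiagonalFactors,
    PNat.mk_coe, Equiv.coe_fn_mk]
  rw [tsum_fintype, Finset.univ_eq_attach,
    (n : ℕ).divisorsAntidiagonal.sum_attach (fun x : ℕ × ℕ => ch x.1 * q ^ (x.1 * x.2)),
    Nat.sum_divisorsAntidiagonal (fun x y => ch x * q ^ (x * y)), R, Int.cast_sum, Finset.sum_mul]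
  refine Finset.sum_congr rfl fun i hi => ?_
  rw [Nat.mul_div_cancel' (Nat.dvd_of_mem_divisors hi), ch]

lemma geom (q : ℂ) (hq : ‖q‖ < 1) : ∑' k : ℕ+, q ^ (k : ℕ) = q / (1 - q) := by
  rw [tsum_pnat_eq_tsum_succ (f := fun k => q ^ k)]
  simp_rw [pow_succ]
  rw [tsum_mul_right, tsum_geometric_of_norm_lt_one hq]
  ring

lemma lam_inner (q : ℂ) (hq : ‖q‖ < 1) (d : ℕ+) :
    ∑' k : ℕ+, ch d * q ^ (d * k : ℕ) = ch d * (q ^ (d : ℕ) / (1 - q ^ (d : ℕ))) := by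
  simp_rw [pow_mul]
  rw [tsum_mul_left, geom]
  rw [norm_pow]
  exact pow_lt_one₀ (norm_nonneg _) hq d.ne_zero

lemma lam_eq (q : ℂ) (hq : ‖q‖ < 1) :
    ∑' c : ℕ+ × ℕ+, ch c.1 * q ^ (c.1 * c.2 : ℕ) = ∑' n : ℕ,
        (q ^ (4 * n + 1) / (1 - q ^ (4 * n + 1)) -
          q ^ (4 * n + 3) / (1 - q ^ (4 * n + 3))) := by
  set f : ℕ → ℂ := fun d => ch d * (q ^ d / (1 - q ^ d)) with hf
  have hs := (summable_lam q hq).prod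
  simp_rw [lam_inner q hq] at hs
  have hs1 : Summable fun n => f (n + 1) := (summable_pnat_iff_summable_succ (f := f)).mp hs
  have hs2 : Summable f := (summable_nat_add_iff 1).mp hs1
  rw [(summable_lam q hq).tsum_prod]
  simp_rw [lam_inner q hq]
  have h0 : f 0 = 0 := by simp [hf]
  have e1 : ∑' d : ℕ+, f d = ∑' n, f n := by
    rw [tsum_pnat_eq_tsum_succ, hs2.tsum_eq_zero_add, h0, zero_add]
  refine e1.trans ?_
  rw [Nat.sumByResidueClasses hs2 4]
  have hv : ∀ j m : ℕ, f (j + 4 * m) =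
      ch j * (q ^ (4 * m + j) / (1 - q ^ (4 * m + j))) := by
    intro j m
    have : ((4 * m : ℕ) : ZMod 4) = 0 := by
      rw [Nat.cast_mul]; rw [show ((4 : ℕ) : ZMod 4) = 0 from rfl, zero_mul]
    simp only [hf, ch]
    rw [Nat.cast_add, this, add_zero, add_comm j]
  have c0 : ch 0 = 0 := by simp [ch]
  have c1 : ch 1 = 1 := by simp [ch]
  have c2 : ch 2 = 0 := by
    rw [ch, show ZMod.χ₄ ((2 : ℕ) : ZMod 4) = 0 by decide]; simp
  have c3 : ch 3 = -1 := by
    rw [ch, show ZMod.χ₄ ((3 : ℕ) : ZMod 4) = -1 by decide]; simp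
  have hinj : ∀ j, Function.Injective fun m : ℕ => j + 4 * m := by
    intro j a b h
    simp only at h
    omega
  have s1 := hs2.comp_injective (hinj 1)
  have s3 := hs2.comp_injective (hinj 3)
  have e2 : ∑ j : ZMod 4, ∑' m, f (j.val + 4 * m) =
      ∑' m, f (0 + 4 * m) + ∑' m, f (1 + 4 * m) + ∑' m, f (2 + 4 * m) + ∑' m, f (3 + 4 * m) :=
    Fin.sum_univ_four (fun j : Fin 4 => ∑' m, f (j.val + 4 * m))
  rw [e2]
  simp only [Function.comp_def] at s1 s3
  simp_rw [hv, c0, c1, c2, c3] at s1 s3 ⊢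
  simp only [zero_mul, tsum_zero, zero_add, add_zero, one_mul] at s1 s3 ⊢
  rw [← s1.tsum_add s3]
  refine tsum_congr fun m => ?_
  ring

end TwoSq


/-- the sum of two squares theorem (Jacobi):
`(Σ_{n ∈ ℤ} q^{n²})² = 1 + 4 Σ_{n ≥ 0} (q^{4n+1}/(1-q^{4n+1}) - q^{4n+3}/(1-q^{4n+3}))`. -/
theorem sum_of_two_squares_identity (q : ℂ) (hq : ‖q‖ < 1) :
    (∑' n : ℤ, q ^ (n.natAbs ^ 2)) ^ 2 =
      1 + 4 * ∑' n : ℕ,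
        (q ^ (4 * n + 1) / (1 - q ^ (4 * n + 1)) -
          q ^ (4 * n + 3) / (1 - q ^ (4 * n + 3))) := by
  have h := TwoSq.theta_sq q hq
  rw [← h.tsum_eq, h.summable.tsum_eq_zero_add, ← TwoSq.lam_eq q hq, TwoSq.lam_R q hq,
    tsum_pnat_eq_tsum_succ (f := fun n => (TwoSq.R n : ℂ) * q ^ n), TwoSq.N_zero, ← tsum_mul_left]
  simp only [Nat.cast_one, pow_zero, mul_one]
  congr 1
  refine tsum_congr fun n => ?_
  have h2 : (TwoSq.N (n + 1) : ℂ) = 4 * (TwoSq.R (n + 1) : ℂ) := by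
    exact_mod_cast congrArg (Int.cast : ℤ → ℂ) (TwoSq.N_eq (n + 1) n.succ_ne_zero)
  rw [h2, mul_assoc]
end

section
/- Let k be an odd positive integer and let h be an integer with 0 ≤ h < k such that no integer ℓ satisfies (2ℓ+1)² ≡ 1 + 8h (mod k). Then c_k^{(3)}(kn + h) = 0 for every integer n ≥ 0. -/
open Finset Filter Topology

/-- Finite Euler product. -/
noncomputable def cbQ (q : ℂ) (n : ℕ) : ℂ := ∏ i ∈ range n, (1 - q ^ (i + 1))

/-- The polynomial of the q-binomial theorem. -/
noncomputable def cbP (q : ℂ) (n : ℕ) : Polynomial ℂ :=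
  ∏ i ∈ range n, (1 - Polynomial.X * Polynomial.C (q ^ i))

/-- Triangular numbers. -/
def cbT (n : ℕ) : ℕ := (n + 1).choose 2

lemma cbT_zero : cbT 0 = 0 := rfl
lemma cbT_succ (n : ℕ) : cbT (n + 1) = cbT n + (n + 1) := by
  simp [cbT, Nat.choose_succ_succ' (n + 1) 1]; ring
lemma cbT_two (n : ℕ) : 2 * cbT n = n * (n + 1) := by
  induction n with
  | zero => rfl
  | succ n ih => rw [cbT_succ]; linarith

lemma cbQ_succ (q : ℂ) (n : ℕ) : cbQ q (n + 1) = cbQ q n * (1 - q ^ (n + 1)) := by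
  simp [cbQ, prod_range_succ]
lemma cbP_succ (q : ℂ) (n : ℕ) :
    cbP q (n + 1) = cbP q n * (1 - Polynomial.X * Polynomial.C (q ^ n)) := by
  simp [cbP, prod_range_succ]

lemma cbP_coeff_succ (q : ℂ) (n m : ℕ) :
    (cbP q (n + 1)).coeff (m + 1) = (cbP q n).coeff (m + 1) - (cbP q n).coeff m * q ^ n := by
  rw [cbP_succ, mul_sub, mul_one, Polynomial.coeff_sub, ← mul_assoc, Polynomial.coeff_mul_C,
    Polynomial.coeff_mul_X]

lemma cbP_coeff_zero (q : ℂ) (n : ℕ) : (cbP q n).coeff 0 = 1 := by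
  induction n with
  | zero => simp [cbP]
  | succ n ih => rw [cbP_succ, Polynomial.mul_coeff_zero, ih]; simp

lemma cbP_natDegree (q : ℂ) (n : ℕ) : (cbP q n).natDegree ≤ n := by
  induction n with
  | zero => simp [cbP]
  | succ n ih =>
    rw [cbP_succ]
    refine Polynomial.natDegree_mul_le.trans (Nat.add_le_add ih ?_)
    compute_degree

/-- q-binomial theorem. -/
lemma cbP_coeff (q : ℂ) (N : ℕ) : ∀ m r : ℕ, m + r = N →
    (cbP q N).coeff m * (cbQ q m * cbQ q r) = (-1) ^ m * q ^ (m.choose 2) * cbQ q N := by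
  induction N with
  | zero =>
    intro m r h
    obtain ⟨rfl, rfl⟩ : m = 0 ∧ r = 0 := by omega
    simp [cbP, cbQ]
  | succ N ih =>
    intro m r h
    rcases m with _ | m
    · obtain rfl : r = N + 1 := by omega
      simp [cbP_coeff_zero, cbQ]
    · rw [cbP_coeff_succ]
      have h2 := ih m r (by omega)
      have hch : (m + 1).choose 2 = m.choose 2 + m := by
        rw [Nat.choose_succ_succ' m 1]; simp; ring
      rcases r with _ | r
      · obtain rfl : m = N := by omega
        have h0 : (cbP q m).coeff (m + 1) = 0 :=
          Polynomial.coeff_eq_zero_of_natDegree_lt (by have := cbP_natDegree q m; omega)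
        rw [h0, hch, cbQ_succ]
        have e : q ^ (m.choose 2 + m) = q ^ (m.choose 2) * q ^ m := pow_add _ _ _
        rw [e]
        linear_combination (- q ^ m * (1 - q ^ (m + 1))) * h2
      · have h1 := ih (m + 1) r (by omega)
        obtain rfl : N = m + r + 1 := by omega
        rw [hch] at h1 ⊢
        rw [cbQ_succ q (m + r + 1)]
        rw [cbQ_succ q r] at h2 ⊢
        rw [cbQ_succ q m] at h1 ⊢
        linear_combination (1 - q ^ (r + 1)) * h1 - (q ^ (m + r + 1) * (1 - q ^ (m + 1))) * h2

lemma cb_inv (q : ℂ) (hq : q ≠ 0) (n : ℕ) :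
    (∏ i ∈ range n, (1 - q⁻¹ ^ (i + 1))) * q ^ cbT n = (-1) ^ n * cbQ q n := by
  induction n with
  | zero => simp [cbQ, cbT]
  | succ n ih =>
    rw [prod_range_succ, cbT_succ, cbQ_succ, pow_add]
    have : q⁻¹ ^ (n + 1) * q ^ (n + 1) = 1 := by rw [← mul_pow]; simp [hq]
    linear_combination (q ^ (n + 1) - 1) * ih
      - (∏ i ∈ range n, (1 - q⁻¹ ^ (i + 1))) * q ^ cbT n * this

lemma cb_deriv (q : ℂ) (hq : q ≠ 0) (n : ℕ) :
    (Polynomial.X * Polynomial.derivative (cbP q (2 * n + 1))).eval (q⁻¹ ^ n) * q ^ cbT n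
      = - ((-1) ^ n * cbQ q n ^ 2) := by
  have hx : q⁻¹ ^ n * q ^ n = 1 := by rw [← mul_pow]; simp [hq]
  have hsplit : cbP q (2 * n + 1) = (1 - Polynomial.X * Polynomial.C (q ^ n)) *
      (cbP q n * ∏ i ∈ range n, (1 - Polynomial.X * Polynomial.C (q ^ (n + 1 + i)))) := by
    rw [show 2 * n + 1 = (n + 1) + n by ring, cbP, prod_range_add, prod_range_succ, cbP]; ring
  have hA : (cbP q n).eval (q⁻¹ ^ n) = ∏ i ∈ range n, (1 - q⁻¹ ^ (i + 1)) := by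
    rw [cbP, Polynomial.eval_prod, ← prod_range_reflect]
    refine prod_congr rfl fun i hi => ?_
    have hi' := mem_range.1 hi
    simp only [Polynomial.eval_sub, Polynomial.eval_one, Polynomial.eval_mul, Polynomial.eval_X,
      Polynomial.eval_C]
    rw [show q⁻¹ ^ n = q⁻¹ ^ (i + 1) * q⁻¹ ^ (n - 1 - i) by rw [← pow_add]; congr 1; omega,
      mul_assoc, ← mul_pow]
    simp [hq]
  have hB : (∏ i ∈ range n, (1 - Polynomial.X * Polynomial.C (q ^ (n + 1 + i)))).eval (q⁻¹ ^ n)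
      = cbQ q n := by
    rw [Polynomial.eval_prod, cbQ]
    refine prod_congr rfl fun i hi => ?_
    simp only [Polynomial.eval_sub, Polynomial.eval_one, Polynomial.eval_mul, Polynomial.eval_X,
      Polynomial.eval_C]
    rw [show n + 1 + i = n + (i + 1) by ring, pow_add, ← mul_assoc, hx, one_mul]
  have hI := cb_inv q hq n
  rw [hsplit, Polynomial.derivative_mul, Polynomial.eval_mul, Polynomial.eval_add,
    Polynomial.eval_mul, Polynomial.eval_mul, Polynomial.eval_mul, hA, hB]
  simp only [Polynomial.derivative_sub, Polynomial.derivative_mul, Polynomial.derivative_one,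
    Polynomial.derivative_X, Polynomial.derivative_C, Polynomial.eval_sub, Polynomial.eval_one,
    Polynomial.eval_mul, Polynomial.eval_X, Polynomial.eval_C, hx, Polynomial.eval_add, one_mul,
    sub_self, zero_mul, add_zero, mul_zero, zero_sub, Polynomial.eval_neg]
  linear_combination (-(∏ i ∈ range n, (1 - q⁻¹ ^ (i + 1))) * cbQ q n * q ^ cbT n) * hx
    - cbQ q n * hI

lemma cb_XD (p : Polynomial ℂ) (N : ℕ) (h : p.natDegree < N) (x : ℂ) :
    (Polynomial.X * Polynomial.derivative p).eval x = ∑ m ∈ range N, (m : ℂ) * p.coeff m * x ^ m := by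
  conv_lhs => rw [p.as_sum_range' N h]
  simp only [Polynomial.derivative_sum, Polynomial.derivative_monomial, Polynomial.eval_mul,
    Polynomial.eval_finsetSum, Polynomial.eval_monomial, Polynomial.eval_X, mul_sum]
  refine sum_congr rfl fun m _ => ?_
  rcases m with _ | m
  · simp
  · simp; ring

lemma cb_split (n : ℕ) (a : ℕ → ℂ) :
    ∑ m ∈ range (2 * n + 2), a m = ∑ j ∈ range (n + 1), (a (n + 1 + j) + a (n - j)) := by
  rw [show 2 * n + 2 = (n + 1) + (n + 1) by ring, sum_range_add, sum_add_distrib, add_comm,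
    ← sum_range_reflect a]
  simp

/-- Finite Jacobi identity. -/
lemma cb_finite (q : ℂ) (hq : q ≠ 0) (hQ : ∀ n, cbQ q n ≠ 0) (n : ℕ) :
    cbQ q n ^ 2 = ∑ j ∈ range (n + 1), (-1) ^ j * (2 * j + 1) * q ^ cbT j *
      (cbQ q (2 * n + 1) / (cbQ q (n + 1 + j) * cbQ q (n - j))) := by
  have h := cb_deriv q hq n
  rw [cb_XD _ (2 * n + 2) (by have := cbP_natDegree q (2 * n + 1); omega), cb_split, sum_mul] at h
  have hs : ((-1 : ℂ) ^ n) * (-1) ^ n = 1 := by rw [← mul_pow]; simp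
  have key : cbQ q n ^ 2 = -(-1) ^ n * (- ((-1) ^ n * cbQ q n ^ 2)) := by
    linear_combination (-cbQ q n ^ 2) * hs
  rw [key, ← h, mul_sum]
  refine sum_congr rfl fun j hj => ?_
  have hj' : j ≤ n := by have := mem_range.1 hj; omega
  obtain ⟨r, rfl⟩ := Nat.exists_eq_add_of_le hj'
  have c1 := cbP_coeff q (2 * (j + r) + 1) (j + r + 1 + j) r (by ring)
  have c2 := cbP_coeff q (2 * (j + r) + 1) r (j + r + 1 + j) (by ring)
  rw [Nat.add_sub_cancel_left]
  have q1 := hQ (j + r + 1 + j)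
  have q2 := hQ r
  rw [← eq_div_iff (mul_ne_zero q1 q2)] at c1
  rw [← eq_div_iff (mul_ne_zero q2 q1)] at c2
  rw [c1, c2]
  have t1 := cbT_two (j + r)
  have t2 := cbT_two j
  have e1 : q⁻¹ ^ (j + r) ^ 1 = q⁻¹ ^ (j + r) := by simp
  have ch1 : 2 * (j + r + 1 + j).choose 2 = (j + r + j) * (j + r + j + 1) := by
    have := cbT_two (j + r + j)
    rw [cbT] at this
    rw [← this]; ring_nf
  have ch2 : 2 * r.choose 2 + r = r * r := by
    rcases r with _ | r
    · rfl
    · have := cbT_two r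
      rw [cbT] at this
      rw [this]; ring
  have x1 : (q⁻¹ ^ (j + r)) ^ (j + r + 1 + j) * (q ^ (j + r + 1 + j).choose 2 * q ^ cbT (j + r))
      = q ^ cbT j := by
    rw [← pow_mul, ← pow_add, show (j + r + 1 + j).choose 2 + cbT (j + r) =
      (j + r) * (j + r + 1 + j) + cbT j by nlinarith, pow_add, ← mul_assoc, ← mul_pow]
    simp [hq]
  have x2 : (q⁻¹ ^ (j + r)) ^ r * (q ^ r.choose 2 * q ^ cbT (j + r)) = q ^ cbT j := by
    rw [← pow_mul, ← pow_add, show r.choose 2 + cbT (j + r) =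
      (j + r) * r + cbT j by nlinarith, pow_add, ← mul_assoc, ← mul_pow]
    simp [hq]
  have s1 : (-1 : ℂ) ^ (j + r) * (-1) ^ (j + r + 1 + j) = - (-1) ^ j := by
    rw [show j + r + 1 + j = (j + r) + (j + 1) by ring, pow_add _ (j + r) (j + 1), ← mul_assoc, hs]
    ring
  have s2 : (-1 : ℂ) ^ (j + r) * (-1) ^ r = (-1) ^ j := by
    rw [pow_add, mul_assoc, ← mul_pow]; simp
  rw [mul_comm (cbQ q r) (cbQ q (j + r + 1 + j))]
  set G := cbQ q (2 * (j + r) + 1)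
  set H := cbQ q (j + r + 1 + j) * cbQ q r
  push_cast
  calc _ = -(((-1 : ℂ) ^ (j + r) * (-1) ^ (j + r + 1 + j)) * (j + r + 1 + j) *
        ((q⁻¹ ^ (j + r)) ^ (j + r + 1 + j) * (q ^ (j + r + 1 + j).choose 2 * q ^ cbT (j + r))) * (G / H)
        + ((-1 : ℂ) ^ (j + r) * (-1) ^ r) * r *
          ((q⁻¹ ^ (j + r)) ^ r * (q ^ r.choose 2 * q ^ cbT (j + r))) * (G / H)) := by ring
    _ = _ := by rw [s1, s2, x1, x2]; ring

lemma cb_jacobi_aux (q : ℂ) (hq0 : q ≠ 0) (hq : ‖q‖ < 1) :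
    HasSum (fun j : ℕ => (-1) ^ j * (2 * (j : ℂ) + 1) * q ^ cbT j)
      ((∏' n : ℕ, (1 - q ^ (n + 1))) ^ 3) := by
  set L : ℂ := ∏' n : ℕ, (1 - q ^ (n + 1)) with hL
  have hne : ∀ i : ℕ, 1 - q ^ (i + 1) ≠ 0 := by
    intro i h
    have h1 : ‖q ^ (i + 1)‖ < 1 := by
      rw [norm_pow]; exact pow_lt_one₀ (norm_nonneg _) hq (by omega)
    rw [← sub_eq_zero.1 h] at h1
    simp at h1
  have hQ : ∀ n, cbQ q n ≠ 0 := fun n => prod_ne_zero_iff.2 fun i _ => hne i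
  have hlim : Tendsto (cbQ q) atTop (𝓝 L) :=
    (ModularForm.multipliable_one_sub_pow hq).hasProd.tendsto_prod_nat
  have hL0 : L ≠ 0 := by
    refine tprod_one_add_ne_zero_of_summable (f := fun n : ℕ ↦ -q ^ (n + 1)) ?_ ?_
    · intro i; simpa [sub_eq_add_neg] using hne i
    · simpa using (summable_nat_add_iff 1).mpr (summable_geometric_of_lt_one (norm_nonneg _) hq)
  have hlimi : Tendsto (fun n => (cbQ q n)⁻¹) atTop (𝓝 L⁻¹) := hlim.inv₀ hL0
  obtain ⟨A, hA⟩ := (Metric.isBounded_range_of_tendsto _ hlim).exists_norm_le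
  obtain ⟨B, hB⟩ := (Metric.isBounded_range_of_tendsto _ hlimi).exists_norm_le
  have hA' : ∀ n, ‖cbQ q n‖ ≤ A := fun n => hA _ ⟨n, rfl⟩
  have hB' : ∀ n, ‖(cbQ q n)⁻¹‖ ≤ B := fun n => hB _ ⟨n, rfl⟩
  have hA0 : 0 ≤ A := (norm_nonneg _).trans (hA' 0)
  have hB0 : 0 ≤ B := (norm_nonneg _).trans (hB' 0)
  have hbs : Summable fun j : ℕ => (2 * (j : ℝ) + 1) * ‖q‖ ^ j := by
    have h1 : Summable fun j : ℕ => (j : ℝ) ^ 1 * ‖q‖ ^ j :=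
      summable_pow_mul_geometric_of_norm_lt_one 1 (by simpa using hq)
    have h2 := summable_geometric_of_lt_one (norm_nonneg q) hq
    refine ((h1.mul_left 2).add h2).congr fun j => ?_
    ring
  have hTle : ∀ j, j ≤ cbT j := fun j => by have := cbT_two j; nlinarith
  have hterm : ∀ j : ℕ, ‖(-1) ^ j * (2 * (j : ℂ) + 1) * q ^ cbT j‖ ≤ (2 * (j : ℝ) + 1) * ‖q‖ ^ j := by
    intro j
    rw [norm_mul, norm_mul, norm_pow, norm_pow, norm_neg, norm_one, one_pow, one_mul]
    have : ‖2 * (j : ℂ) + 1‖ = 2 * (j : ℝ) + 1 := by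
      rw [show 2 * (j : ℂ) + 1 = ((2 * j + 1 : ℕ) : ℂ) by push_cast; ring, Complex.norm_natCast]
      push_cast; ring
    rw [this]
    exact mul_le_mul_of_nonneg_left (pow_le_pow_of_le_one (norm_nonneg _) hq.le (hTle j))
      (by positivity)
  have hsum : Summable fun j : ℕ => (-1) ^ j * (2 * (j : ℂ) + 1) * q ^ cbT j :=
    Summable.of_norm_bounded hbs hterm
  let f : ℕ → ℕ → ℂ := fun n j => if j ∈ range (n + 1) then (-1) ^ j * (2 * (j : ℂ) + 1) * q ^ cbT j *
      (cbQ q (2 * n + 1) / (cbQ q (n + 1 + j) * cbQ q (n - j))) else 0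
  have hf : ∀ n, ∑' j, f n j = cbQ q n ^ 2 := by
    intro n
    rw [cb_finite q hq0 hQ n, tsum_eq_sum (s := range (n + 1)) (fun j hj => if_neg hj)]
    exact sum_congr rfl fun j hj => if_pos hj
  have hdom : Tendsto (fun n => ∑' j, f n j) atTop
      (𝓝 (∑' j : ℕ, (-1) ^ j * (2 * (j : ℂ) + 1) * q ^ cbT j * (L / (L * L)))) := by
    refine tendsto_tsum_of_dominated_convergence
      (bound := fun j : ℕ => (2 * (j : ℝ) + 1) * ‖q‖ ^ j * (A * (B * B))) (hbs.mul_right _) ?_ ?_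
    · intro j
      have t1 : Tendsto (fun n : ℕ => 2 * n + 1) atTop atTop :=
        tendsto_atTop_mono (fun n => by simp only [id]; omega) tendsto_id
      have t2 : Tendsto (fun n : ℕ => n + 1 + j) atTop atTop :=
        tendsto_atTop_mono (fun n => by simp only [id]; omega) tendsto_id
      have t3 : Tendsto (fun n : ℕ => n - j) atTop atTop := tendsto_sub_atTop_nat j
      have t := ((hlim.comp t1).div ((hlim.comp t2).mul (hlim.comp t3)) (mul_ne_zero hL0 hL0)).const_mul
        ((-1) ^ j * (2 * (j : ℂ) + 1) * q ^ cbT j)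
      refine t.congr' ?_
      filter_upwards [eventually_ge_atTop j] with n hn
      have : j ∈ range (n + 1) := mem_range.2 (by omega)
      simp only [f, if_pos this, Function.comp, Pi.div_apply]
    · refine Eventually.of_forall fun n j => ?_
      simp only [f]
      split_ifs
      · rw [norm_mul, div_eq_mul_inv, mul_inv, norm_mul (cbQ q (2 * n + 1)), norm_mul (cbQ q _)⁻¹]
        gcongr
        · exact hterm j
        · exact hA' _
        · exact hB' _
        · exact hB' _
      · rw [norm_zero]; positivity
  simp_rw [hf] at hdom
  have huniq := tendsto_nhds_unique hdom (hlim.pow 2)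
  rw [tsum_mul_right] at huniq
  have : ∑' j : ℕ, (-1) ^ j * (2 * (j : ℂ) + 1) * q ^ cbT j = L ^ 3 := by
    field_simp at huniq
    rw [huniq]
  rw [← this]
  exact hsum.hasSum

lemma cbT_strictMono : StrictMono cbT := strictMono_nat_of_lt_succ fun n => by rw [cbT_succ]; omega

/-- Coefficients of the cube of the Euler product. -/
noncomputable def cbB : ℕ → ℂ := Function.extend cbT (fun j : ℕ => (-1) ^ j * (2 * (j : ℂ) + 1)) 0

lemma cbB_T (j : ℕ) : cbB (cbT j) = (-1) ^ j * (2 * (j : ℂ) + 1) :=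
  cbT_strictMono.injective.extend_apply _ _ _

lemma cbB_zero : cbB 0 = 1 := by
  have := cbB_T 0
  simpa [cbT_zero] using this

lemma cbB_ne (n : ℕ) (h : ¬ ∃ j, cbT j = n) : cbB n = 0 := Function.extend_apply' _ _ _ h

lemma cb_jacobi (q : ℂ) (hq : ‖q‖ < 1) :
    HasSum (fun n : ℕ => cbB n * q ^ n) ((∏' n : ℕ, (1 - q ^ (n + 1))) ^ 3) := by
  by_cases hq0 : q = 0
  · subst hq0
    convert hasSum_single (f := fun n : ℕ => cbB n * (0 : ℂ) ^ n) 0 ?_ using 1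
    · simp [cbB_zero]
    · intro n hn; simp [hn]
  · refine (cbT_strictMono.injective.hasSum_iff ?_).1 ?_
    · intro n hn
      rw [cbB_ne n (by simpa using hn), zero_mul]
    · convert cb_jacobi_aux q hq0 hq using 2 with j
      simp [cbB_T]

lemma cb_prod (k : ℕ) (hk : 0 < k) (q : ℂ) (hq : ‖q‖ < 1) :
    (∏' n : ℕ, if k ∣ (n + 1) then 1 else (1 - q ^ (n + 1))) * ∏' n : ℕ, (1 - (q ^ k) ^ (n + 1))
      = ∏' n : ℕ, (1 - q ^ (n + 1)) := by
  have hs : Summable fun n : ℕ => ‖q‖ ^ (n + 1) :=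
    (summable_nat_add_iff 1).mpr (summable_geometric_of_lt_one (norm_nonneg _) hq)
  have m1 : Multipliable fun n : ℕ => if k ∣ (n + 1) then (1 : ℂ) else (1 - q ^ (n + 1)) := by
    have := multipliable_one_add_of_summable (f := fun n : ℕ => if k ∣ (n + 1) then (0 : ℂ) else - q ^ (n + 1))
      (Summable.of_nonneg_of_le (fun _ => norm_nonneg _) (fun n => by
        split_ifs <;> simp) hs)
    refine this.congr fun n => ?_
    split_ifs <;> ring
  have m2 : HasProd (fun n : ℕ => if k ∣ (n + 1) then (1 - q ^ (n + 1)) else (1 : ℂ))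
      (∏' n : ℕ, (1 - (q ^ k) ^ (n + 1))) := by
    have hqk : ‖q ^ k‖ < 1 := by
      rw [norm_pow]; exact pow_lt_one₀ (norm_nonneg _) hq (by omega)
    have h1 := (ModularForm.multipliable_one_sub_pow hqk).hasProd
    have hpos : ∀ n : ℕ, k * (n + 1) - 1 + 1 = k * (n + 1) := fun n =>
      Nat.sub_add_cancel (Nat.mul_pos hk (by omega))
    have hinj : Function.Injective fun n : ℕ => k * (n + 1) - 1 := by
      intro a b hab
      have hab' : k * (a + 1) - 1 = k * (b + 1) - 1 := hab
      have : k * (a + 1) = k * (b + 1) := by rw [← hpos a, ← hpos b, hab']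
      have := Nat.eq_of_mul_eq_mul_left hk this
      omega
    refine (hinj.hasProd_iff ?_).1 ?_
    · intro n hn
      refine if_neg fun hd => hn ?_
      obtain ⟨m, hm⟩ := hd
      rcases m with _ | m
      · simp at hm
      · exact ⟨m, by simp only; omega⟩
    · convert h1 using 2 with n
      simp only [Function.comp, hpos, dvd_mul_right, if_true, pow_mul]
  rw [← m2.tprod_eq, ← m1.tprod_mul m2.multipliable]
  refine tprod_congr fun n => ?_
  split_ifs <;> simp

lemma cb_unique (a b : ℕ → ℂ) (g : ℂ → ℂ)
    (ha : ∀ q : ℂ, ‖q‖ < 1 → HasSum (fun n : ℕ => a n * q ^ n) (g q))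
    (hb : ∀ q : ℂ, ‖q‖ < 1 → HasSum (fun n : ℕ => b n * q ^ n) (g q)) : a = b := by
  have key : ∀ a : ℕ → ℂ, (∀ q : ℂ, ‖q‖ < 1 → HasSum (fun n : ℕ => a n * q ^ n) (g q)) →
      HasFPowerSeriesAt g (FormalMultilinearSeries.ofScalars ℂ a) 0 := by
    intro a ha
    rw [hasFPowerSeriesAt_iff]
    filter_upwards [Metric.ball_mem_nhds (0 : ℂ) one_pos] with z hz
    have := ha z (by simpa using hz)
    simpa [FormalMultilinearSeries.coeff_ofScalars, mul_comm] using this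
  have h := (key a ha).eq_formalMultilinearSeries (key b hb)
  funext n
  have := congrArg (fun p => FormalMultilinearSeries.coeff p n) h
  simpa [FormalMultilinearSeries.coeff_ofScalars] using this

/-- Coefficients of the cube of the Euler product evaluated at the k-th power. -/
noncomputable def cbD (k n : ℕ) : ℂ := if k ∣ n then cbB (n / k) else 0

lemma cbD_hasSum (k : ℕ) (hk : 0 < k) (q : ℂ) (hq : ‖q‖ < 1) :
    HasSum (fun n : ℕ => cbD k n * q ^ n) ((∏' n : ℕ, (1 - (q ^ k) ^ (n + 1))) ^ 3) := by
  have hqk : ‖q ^ k‖ < 1 := by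
    rw [norm_pow]; exact pow_lt_one₀ (norm_nonneg _) hq (by omega)
  have hinj : Function.Injective fun n : ℕ => k * n := fun a b h => Nat.eq_of_mul_eq_mul_left hk h
  refine (hinj.hasSum_iff ?_).1 ?_
  · intro n hn
    rw [cbD, if_neg, zero_mul]
    rintro ⟨m, rfl⟩
    exact hn ⟨m, rfl⟩
  · convert cb_jacobi (q ^ k) hqk using 2 with n
    simp [cbD, Nat.mul_div_cancel_left _ hk, pow_mul]


/-- vanishing of cubic Borwein coefficients. If `k` is an odd positive
integer, `0 ≤ h < k`, and no integer `ℓ` satisfies `(2ℓ+1)² ≡ 1 + 8h (mod k)`, then the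
coefficients `c_k^{(3)}` of `((q;q)_∞/(q^k;q^k)_∞)³` satisfy `c_k^{(3)}(kn + h) = 0`. -/
theorem cubic_borwein_vanishing (k : ℕ) (hk : 0 < k) (hko : Odd k)
    (h : ℕ) (hh : h < k)
    (hno : ¬ ∃ l : ℤ, (2 * l + 1) ^ 2 ≡ 1 + 8 * (h : ℤ) [ZMOD (k : ℤ)])
    (c : ℕ → ℤ)
    (hc : ∀ q : ℂ, ‖q‖ < 1 →
      HasSum (fun n : ℕ => (c n : ℂ) * q ^ n)
        ((∏' n : ℕ, if k ∣ (n + 1) then 1 else (1 - q ^ (n + 1))) ^ 3)) :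
    ∀ n : ℕ, c (k * n + h) = 0 := by

  have hconv : (fun n => ∑ i ∈ range (n + 1), (c i : ℂ) * cbD k (n - i)) = cbB := by
    refine cb_unique _ _ (fun q => (∏' n : ℕ, (1 - q ^ (n + 1))) ^ 3) ?_ cb_jacobi
    intro q hq
    have h1 := hc q hq
    have h2 := cbD_hasSum k hk q hq
    have h3 := hasSum_sum_range_mul_of_summable_norm h1.summable.norm h2.summable.norm
    rw [h1.tsum_eq, h2.tsum_eq, ← mul_pow, cb_prod k hk q hq] at h3
    refine Eq.mp (congrArg (fun F : ℕ → ℂ => HasSum F _) (funext fun n => ?_)) h3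
    rw [sum_mul]
    symm
    refine sum_congr rfl fun i hi => ?_
    have hi' : i ≤ n := by have := mem_range.1 hi; omega
    rw [show q ^ n = q ^ i * q ^ (n - i) by rw [← pow_add]; congr 1; omega]
    ring
  intro n
  induction n using Nat.strong_induction_on with
  | _ n ih =>
    have h1 := congrFun hconv (k * n + h)
    have hB : cbB (k * n + h) = 0 := by
      refine cbB_ne _ ?_
      rintro ⟨j, hj⟩
      refine hno ⟨j, ?_⟩
      have t := cbT_two j
      rw [hj] at t
      have t' : 2 * ((k : ℤ) * n + h) = j * (j + 1) := by exact_mod_cast t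
      refine (Int.modEq_iff_dvd.2 ⟨-(8 * n), ?_⟩)
      linear_combination 4 * t'
    simp only [sum_range_succ, hB, Nat.sub_self] at h1
    rw [sum_eq_zero] at h1
    · simpa [cbD, cbB_zero] using h1
    · intro i hi
      have hi' := mem_range.1 hi
      by_cases hd : k ∣ (k * n + h - i)
      · obtain ⟨m, hm⟩ := hd
        have hm0 : 0 < m := by
          rcases m with _ | m
          · simp at hm; omega
          · omega
        have hmn : m ≤ n := by
          by_contra hcon
          have : k * (n + 1) ≤ k * m := Nat.mul_le_mul_left k (by omega)
          rw [mul_add] at this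
          omega
        obtain ⟨r, rfl⟩ := Nat.exists_eq_add_of_le hmn
        have hir : i = k * r + h := by
          rw [mul_add] at hm hi'
          omega
        rw [hir, ih r (by omega)]
        simp
      · simp [cbD, hd]
end

section
/- Let k be a positive integer, let z be a nonzero complex number, and let q be a complex number with 0 < ‖q‖ < 1. Then θ(z;q) = ( (q^{k²};q^{k²})_∞ / (q;q)_∞ ) · Σ_{ℓ=⌈(1−k)/2⌉}^{⌈(k−1)/2⌉} (−1)^ℓ q^{ℓ(ℓ−1)/2} z^ℓ · θ( (−1)^{k−1} z^k q^{k(k−1+2ℓ)/2} ; q^{k²} ), where z^ℓ is the integer power of z (ℓ may be negative), and all exponents q^{ℓ(ℓ−1)/2} and q^{k(k−1+2ℓ)/2} occurring are nonnegative integer powers of q. -/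
/-- The modified Jacobi theta function `θ(z;q) = (z, q/z; q)_∞`. -/
noncomputable def jacobiTheta' (z q : ℂ) : ℂ :=
  ∏' j : ℕ, (1 - z * q ^ j) * (1 - q ^ (j + 1) / z)

open Filter Topology

namespace ThetaDis

/-- triangular exponent -/
def E (n : ℤ) : ℤ := n * (n - 1) / 2

lemma two_E (n : ℤ) : 2 * E n = n * (n - 1) := by
  unfold E
  apply Int.mul_ediv_cancel'
  exact (Int.even_mul_pred_self n).two_dvd

lemma E_nonneg (n : ℤ) : 0 ≤ E n := by
  have h := two_E n
  rcases le_or_gt n 0 with h0 | h0 <;> nlinarith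

lemma E_succ (n : ℤ) : E (n + 1) = E n + n := by
  have h1 := two_E n
  have h2 := two_E (n + 1)
  linarith

/-- term of the theta series -/
noncomputable def a (z q : ℂ) (n : ℤ) : ℂ := (-1 : ℂ) ^ n * q ^ (E n) * z ^ n

lemma a_succ {z q : ℂ} (hz : z ≠ 0) (hq : q ≠ 0) (n : ℤ) :
    a z q (n + 1) = -(z * q ^ n) * a z q n := by
  unfold a
  rw [E_succ, zpow_add₀ hq, zpow_add_one₀ hz, zpow_add_one₀ (by norm_num)]
  ring

lemma a_ne {z q : ℂ} (hz : z ≠ 0) (hq : q ≠ 0) (n : ℤ) : a z q n ≠ 0 := by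
  unfold a
  have := zpow_ne_zero n (show (-1 : ℂ) ≠ 0 by norm_num)
  have := zpow_ne_zero (E n) hq
  have := zpow_ne_zero n hz
  positivity

lemma summable_a {z q : ℂ} (hz : z ≠ 0) (hq : q ≠ 0) (hq1 : ‖q‖ < 1) :
    Summable (a z q) := by
  have hp : Tendsto (fun n : ℕ => ‖q‖ ^ n) atTop (𝓝 0) :=
    tendsto_pow_atTop_nhds_zero_of_lt_one (norm_nonneg _) hq1
  apply Summable.of_nat_of_neg
  · apply summable_of_ratio_test_tendsto_lt_one (l := 0) one_pos
    · exact Eventually.of_forall fun n => a_ne hz hq _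
    · have : Tendsto (fun n : ℕ => ‖z‖ * ‖q‖ ^ n) atTop (𝓝 0) := by
        simpa using hp.const_mul ‖z‖
      refine this.congr fun n => ?_
      push_cast
      rw [a_succ hz hq, norm_mul, mul_div_cancel_right₀ _ (by simpa using a_ne hz hq _)]
      simp
  · apply summable_of_ratio_test_tendsto_lt_one (l := 0) one_pos
    · exact Eventually.of_forall fun n => a_ne hz hq _
    · have : Tendsto (fun n : ℕ => ‖z‖⁻¹ * ‖q‖ * ‖q‖ ^ n) atTop (𝓝 0) := by
        simpa using hp.const_mul (‖z‖⁻¹ * ‖q‖)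
      refine this.congr fun n => ?_
      have h := a_succ hz hq (-((n + 1 : ℕ) : ℤ))
      have e : (-((n + 1 : ℕ) : ℤ)) + 1 = -(n : ℤ) := by push_cast; ring
      rw [e] at h
      have hn := a_ne hz hq (-((n + 1 : ℕ) : ℤ))
      rw [h, norm_mul, div_mul_cancel_right₀ (by simpa using hn)]
      rw [zpow_neg, zpow_natCast]
      simp [pow_succ]
      ring

/-- finite Euler product -/
noncomputable def P (q : ℂ) (n : ℕ) : ℂ := ∏ i ∈ Finset.range n, (1 - q ^ (i + 1))

/-- infinite Euler product -/
noncomputable def Pinf (q : ℂ) : ℂ := ∏' n : ℕ, (1 - q ^ (n + 1))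

lemma one_sub_ne {q : ℂ} (hq1 : ‖q‖ < 1) (i : ℕ) : 1 - q ^ (i + 1) ≠ 0 := by
  intro h
  have h1 : q ^ (i + 1) = 1 := (sub_eq_zero.mp h).symm
  have h2 : ‖q‖ ^ (i + 1) = 1 := by rw [← norm_pow, h1, norm_one]
  have h3 : ‖q‖ ^ (i + 1) < 1 := pow_lt_one₀ (norm_nonneg _) hq1 (by omega)
  linarith

lemma P_ne {q : ℂ} (hq1 : ‖q‖ < 1) (n : ℕ) : P q n ≠ 0 :=
  Finset.prod_ne_zero_iff.mpr fun i _ => one_sub_ne hq1 i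

lemma summable_geo {q : ℂ} (hq1 : ‖q‖ < 1) (c : ℂ) : Summable fun j : ℕ => ‖-(c * q ^ j)‖ := by
  simp only [norm_neg, norm_mul, norm_pow]
  exact (summable_geometric_of_lt_one (norm_nonneg _) hq1).mul_left _

lemma mult_geo {q : ℂ} (hq1 : ‖q‖ < 1) (c : ℂ) : Multipliable fun j : ℕ => (1 - c * q ^ j) := by
  have := multipliable_one_add_of_summable (summable_geo hq1 c)
  simpa [sub_eq_add_neg] using this

lemma P_tendsto {q : ℂ} (hq1 : ‖q‖ < 1) : Tendsto (P q) atTop (𝓝 (Pinf q)) := by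
  have := mult_geo hq1 q
  have h2 := this.tendsto_prod_tprod_nat
  unfold Pinf P
  simpa only [pow_succ'] using h2

lemma Pinf_ne {q : ℂ} (hq1 : ‖q‖ < 1) : Pinf q ≠ 0 := by
  have := tprod_one_add_ne_zero_of_summable (f := fun j : ℕ => -(q * q ^ j)) (fun i => by
    have := one_sub_ne hq1 i
    rwa [pow_succ', sub_eq_add_neg] at this) (summable_geo hq1 q)
  unfold Pinf
  simpa only [pow_succ', sub_eq_add_neg] using this

/-- reciprocal finite product, extended by zero -/
noncomputable def R (q : ℂ) (n : ℤ) : ℂ := if 0 ≤ n then (P q n.toNat)⁻¹ else 0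

lemma R_rec {q : ℂ} (hq1 : ‖q‖ < 1) (n : ℤ) : R q (n - 1) = (1 - q ^ n) * R q n := by
  rcases lt_trichotomy n 0 with h | h | h
  · simp [R, not_le.mpr h, show ¬ (1 ≤ n) by omega]
  · subst h; simp [R]
  · obtain ⟨m, rfl⟩ : ∃ m : ℕ, n = (m : ℤ) + 1 := ⟨(n - 1).toNat, by omega⟩
    have h1 : ((m : ℤ) + 1).toNat = m + 1 := by omega
    have h0 : (0 : ℤ) ≤ (m : ℤ) + 1 := by omega
    have hne := one_sub_ne hq1 m
    have hP := P_ne hq1 m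
    have e : q ^ ((m : ℤ) + 1) = q ^ (m + 1) := by exact_mod_cast zpow_natCast q (m + 1)
    have e2 : P q (m + 1) = P q m * (1 - q ^ (m + 1)) := Finset.prod_range_succ _ _
    simp only [R, h1, h0, if_true, add_sub_cancel_right, Int.toNat_natCast, Nat.cast_nonneg, e, e2]
    field_simp

lemma R_tendsto {q : ℂ} (hq1 : ‖q‖ < 1) : Tendsto (R q) atTop (𝓝 (Pinf q)⁻¹) := by
  have h1 := (P_tendsto hq1).inv₀ (Pinf_ne hq1)
  have h2 : Tendsto Int.toNat atTop atTop :=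
    tendsto_atTop.mpr fun b => (eventually_ge_atTop (b : ℤ)).mono fun n hn => by omega
  refine (h1.comp h2).congr' ?_
  filter_upwards [eventually_ge_atTop (0 : ℤ)] with n hn
  simp [R, hn]

lemma R_bdd {q : ℂ} (hq1 : ‖q‖ < 1) : ∃ C, 0 ≤ C ∧ ∀ n, ‖R q n‖ ≤ C := by
  have h1 := (P_tendsto hq1).inv₀ (Pinf_ne hq1)
  obtain ⟨C, hC⟩ := (Metric.isBounded_range_of_tendsto _ h1).exists_norm_le
  have hC' : ∀ n, ‖(P q n)⁻¹‖ ≤ C := fun n => hC _ ⟨n, rfl⟩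
  refine ⟨C, (norm_nonneg _).trans (hC' 0), fun n => ?_⟩
  unfold R
  split_ifs
  · exact hC' _
  · simpa using (norm_nonneg _).trans (hC' 0)

/-- central Gaussian binomial -/
noncomputable def c (q : ℂ) (N : ℕ) (n : ℤ) : ℂ := P q (2 * N) * R q (N - n) * R q (N + n)

lemma c_rec {q : ℂ} (hq : q ≠ 0) (hq1 : ‖q‖ < 1) (N : ℕ) (n : ℤ) :
    c q (N + 1) n = (1 + q ^ (2 * N + 1)) * c q N n + q ^ (N + 1 - n) * c q N (n - 1)
      + q ^ (N + 1 + n) * c q N (n + 1) := by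
  have e : P q (2 * (N + 1)) = P q (2 * N) * (1 - q ^ (2 * N + 1)) * (1 - q ^ (2 * N + 2)) := by
    rw [show 2 * (N + 1) = 2 * N + 1 + 1 by ring]
    unfold P
    rw [Finset.prod_range_succ, Finset.prod_range_succ]
  have hx1 := R_rec hq1 ((N : ℤ) + 1 - n)
  have hx2 := R_rec hq1 ((N : ℤ) - n)
  have hy1 := R_rec hq1 ((N : ℤ) + 1 + n)
  have hy2 := R_rec hq1 ((N : ℤ) + n)
  rw [show (N : ℤ) + 1 - n - 1 = N - n by ring] at hx1
  rw [show (N : ℤ) + 1 + n - 1 = N + n by ring] at hy1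
  have exy : q ^ ((N : ℤ) - n) * q ^ ((N : ℤ) + n) = q ^ (2 * N) := by
    rw [← zpow_add₀ hq, show (N : ℤ) - n + (N + n) = ((2 * N : ℕ) : ℤ) by push_cast; ring,
      zpow_natCast]
  have ex : q ^ ((N : ℤ) + 1 - n) = q ^ ((N : ℤ) - n) * q := by
    rw [← zpow_add_one₀ hq]; congr 1; ring
  have ey : q ^ ((N : ℤ) + 1 + n) = q ^ ((N : ℤ) + n) * q := by
    rw [← zpow_add_one₀ hq]; congr 1; ring
  unfold c
  rw [e]
  push_cast
  rw [show (N : ℤ) - (n - 1) = N + 1 - n by ring, show (N : ℤ) + (n - 1) = N + n - 1 by ring,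
    show (N : ℤ) - (n + 1) = N - n - 1 by ring, show (N : ℤ) + (n + 1) = N + 1 + n by ring]
  rw [hx2, hy2, hx1, hy1, ex, ey, pow_succ, pow_add, ← exy]
  ring

lemma hasSum_of_eq {f g : ℤ → ℂ} {x y : ℂ} (h : HasSum f x) (hf : g = f) (hx : y = x) :
    HasSum g y := by
  rw [hf, hx]; exact h

lemma finite_jtp {z q : ℂ} (hz : z ≠ 0) (hq : q ≠ 0) (hq1 : ‖q‖ < 1) (N : ℕ) :
    HasSum (fun n : ℤ => c q N n * a z q n)
      (∏ j ∈ Finset.range N, (1 - z * q ^ j) * (1 - q ^ (j + 1) / z)) := by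
  induction N with
  | zero =>
    have h := hasSum_single (f := fun n : ℤ => c q 0 n * a z q n) 0 (by
      intro n hn
      have : c q 0 n = 0 := by
        unfold c R
        rcases lt_or_gt_of_ne hn with h | h
        · simp [not_le.mpr h]
        · simp [not_le.mpr h]
      simp [this])
    simpa [c, R, P, a, E] using h
  | succ N ih =>
    rw [Finset.prod_range_succ]
    have h1 := ih.mul_left (1 + q ^ (2 * N + 1))
    have h2 := ((Equiv.subRight (1 : ℤ)).hasSum_iff.mpr ih).mul_left (-(z * q ^ N))
    have h3 := ((Equiv.addRight (1 : ℤ)).hasSum_iff.mpr ih).mul_left (-(q ^ (N + 1) / z))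
    have h := (h1.add h2).add h3
    refine hasSum_of_eq h ?_ ?_
    · funext n
      simp only [Function.comp, Equiv.subRight_apply, Equiv.coe_addRight]
      rw [c_rec hq hq1]
      have s1 := a_succ hz hq n
      have s2 := a_succ hz hq (n - 1)
      rw [sub_add_cancel] at s2
      have e1 : q ^ ((N : ℤ) + 1 - n) * q ^ (n - 1) = q ^ N := by
        rw [← zpow_add₀ hq, ← zpow_natCast]; congr 1; ring
      have e2 : q ^ ((N : ℤ) + 1 + n) = q ^ (N + 1) * q ^ n := by
        rw [zpow_add₀ hq]; congr 1
      have t1 : q ^ ((N : ℤ) + 1 - n) * a z q n = -(z * q ^ N) * a z q (n - 1) := by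
        rw [s2, ← e1]; ring
      have t2 : q ^ ((N : ℤ) + 1 + n) * a z q n = -(q ^ (N + 1) / z) * a z q (n + 1) := by
        rw [s1, e2]; field_simp
      linear_combination c q N (n - 1) * t1 + c q N (n + 1) * t2
    · have e : q ^ (2 * N + 1) = q ^ N * q ^ (N + 1) := by rw [← pow_add]; congr 1; ring
      rw [e]
      field_simp
      ring

theorem jtp {z q : ℂ} (hz : z ≠ 0) (hq : q ≠ 0) (hq1 : ‖q‖ < 1) :
    ∑' n, a z q n = Pinf q * jacobiTheta' z q := by
  obtain ⟨C, hC0, hC⟩ := R_bdd hq1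
  obtain ⟨D, hD⟩ := (Metric.isBounded_range_of_tendsto _ (P_tendsto hq1)).exists_norm_le
  have hD' : ∀ n, ‖P q n‖ ≤ D := fun n => hD _ ⟨n, rfl⟩
  have hD0 : 0 ≤ D := (norm_nonneg _).trans (hD' 0)
  have hne := Pinf_ne hq1
  have hlim : Tendsto (fun N : ℕ => ∑' n, c q N n * a z q n) atTop
      (𝓝 (∑' n, (Pinf q)⁻¹ * a z q n)) := by
    apply tendsto_tsum_of_dominated_convergence (bound := fun n => D * C * C * ‖a z q n‖)
    · exact (summable_a hz hq hq1).norm.mul_left _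
    · intro n
      refine Tendsto.mul_const _ ?_
      have t1 : Tendsto (fun N : ℕ => P q (2 * N)) atTop (𝓝 (Pinf q)) :=
        (P_tendsto hq1).comp (tendsto_atTop.mpr fun b =>
          (eventually_ge_atTop b).mono fun n hn => by omega)
      have t2 : Tendsto (fun N : ℕ => R q (N - n)) atTop (𝓝 (Pinf q)⁻¹) :=
        (R_tendsto hq1).comp (tendsto_atTop.mpr fun b =>
          (eventually_ge_atTop (b + n).toNat).mono fun m hn => by omega)
      have t3 : Tendsto (fun N : ℕ => R q (N + n)) atTop (𝓝 (Pinf q)⁻¹) :=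
        (R_tendsto hq1).comp (tendsto_atTop.mpr fun b =>
          (eventually_ge_atTop (b - n).toNat).mono fun m hn => by omega)
      have := (t1.mul t2).mul t3
      rwa [mul_inv_cancel₀ hne, one_mul] at this
    · refine Eventually.of_forall fun N n => ?_
      rw [norm_mul]
      refine mul_le_mul_of_nonneg_right ?_ (norm_nonneg _)
      unfold c
      rw [norm_mul, norm_mul]
      exact mul_le_mul (mul_le_mul (hD' _) (hC _) (norm_nonneg _) hD0) (hC _) (norm_nonneg _)
        (mul_nonneg hD0 hC0)
  have hm : Multipliable fun j : ℕ => (1 - z * q ^ j) * (1 - q ^ (j + 1) / z) := by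
    have h2 : Multipliable fun j : ℕ => (1 - q ^ (j + 1) / z) :=
      (mult_geo hq1 (q / z)).congr fun j => by rw [pow_succ]; ring
    exact (mult_geo hq1 z).mul h2
  have h1 := hm.tendsto_prod_tprod_nat
  have h2 := hlim.congr fun N => (finite_jtp hz hq hq1 N).tsum_eq
  have h3 := tendsto_nhds_unique h1 h2
  rw [tsum_mul_left] at h3
  unfold jacobiTheta'
  rw [h3, mul_inv_cancel_left₀ hne]

lemma two_F (k : ℕ) (l : ℤ) :
    2 * ((k : ℤ) * ((k : ℤ) - 1 + 2 * l) / 2) = (k : ℤ) * ((k : ℤ) - 1 + 2 * l) := by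
  apply Int.mul_ediv_cancel'
  have h := (Int.even_mul_pred_self (k : ℤ)).two_dvd
  have e : (k : ℤ) * ((k : ℤ) - 1 + 2 * l) = k * (k - 1) + 2 * (k * l) := by ring
  rw [e]
  exact dvd_add h (dvd_mul_right _ _)

lemma a_split {k : ℕ} (hk : 0 < k) {z q : ℂ} (hz : z ≠ 0) (hq : q ≠ 0) (m l F : ℤ)
    (hF : 2 * F = (k : ℤ) * ((k : ℤ) - 1 + 2 * l)) :
    a z q (k * m + l) = a z q l * a ((-1 : ℂ) ^ (k - 1) * z ^ k * q ^ F) (q ^ (k ^ 2)) m := by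
  have hE : E (k * m + l) = E l + (k : ℤ) ^ 2 * E m + F * m := by
    have h1 := two_E (k * m + l)
    have h2 := two_E l
    have h3 := two_E m
    have h4 : 2 * E (k * m + l) = 2 * (E l + (k : ℤ) ^ 2 * E m + F * m) := by
      linear_combination h1 - h2 - (k : ℤ) ^ 2 * h3 - m * hF
    omega
  unfold a
  have hm1 : (-1 : ℂ) ≠ 0 := by norm_num
  rw [hE, zpow_add₀ hq, zpow_add₀ hq, zpow_add₀ hz, zpow_add₀ hm1, mul_zpow, mul_zpow,
    zpow_mul q F m, zpow_mul q ((k : ℤ) ^ 2), zpow_mul z, zpow_mul (-1 : ℂ) (k : ℤ) m]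
  have s : ((-1 : ℂ) ^ (k : ℤ)) ^ m = (-1) ^ m * ((-1) ^ (k - 1)) ^ m := by
    rw [← mul_zpow, ← pow_succ', zpow_natCast, Nat.sub_add_cancel hk]
  rw [s, zpow_natCast, show (k : ℤ) ^ 2 = ((k ^ 2 : ℕ) : ℤ) by push_cast; ring, zpow_natCast]
  ring

lemma reindex {k : ℕ} (hk : 0 < k) (f : ℤ → ℂ) (hsum : Summable f) :
    ∑' n, f n = ∑ l ∈ Finset.Icc (-(((k - 1) / 2 : ℕ) : ℤ)) ((k / 2 : ℕ) : ℤ),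
      ∑' m : ℤ, f (k * m + l) := by
  have : NeZero k := ⟨hk.ne'⟩
  set s : ℤ := (((k - 1) / 2 : ℕ) : ℤ) with hs
  have hsum2 : Summable (fun p : ℤ × Fin k =>
      f (((Int.divModEquiv k).symm p) - s)) :=
    ((Int.divModEquiv k).symm.trans (Equiv.subRight s)).summable_iff.mpr hsum
  have e1 : ∑' n, f n = ∑' p : ℤ × Fin k, f (((Int.divModEquiv k).symm p) - s) :=
    (((Int.divModEquiv k).symm.trans (Equiv.subRight s)).tsum_eq f).symm
  have e2 : ∑' p : ℤ × Fin k, f (((Int.divModEquiv k).symm p) - s)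
      = ∑' r : Fin k, ∑' m : ℤ, f (((Int.divModEquiv k).symm (m, r)) - s) := by
    rw [← (Equiv.prodComm (Fin k) ℤ).tsum_eq]
    exact Summable.tsum_prod ((Equiv.prodComm (Fin k) ℤ).summable_iff.mpr hsum2)
  rw [e1, e2, tsum_fintype]
  have e3 : ∀ r : Fin k, ∑' m : ℤ, f (((Int.divModEquiv k).symm (m, r)) - s)
      = (fun i : ℕ => ∑' m : ℤ, f (k * m + ((i : ℤ) - s))) r := by
    intro r
    refine tsum_congr fun m => ?_
    congr 1
    simp [Int.divModEquiv]
    ring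
  rw [Finset.sum_congr rfl fun r _ => e3 r, Fin.sum_univ_eq_sum_range
    (fun i : ℕ => ∑' m : ℤ, f (k * m + ((i : ℤ) - s)))]
  refine Finset.sum_bij' (fun i _ => (i : ℤ) - s) (fun l _ => (l + s).toNat) ?_ ?_ ?_ ?_ ?_
  · intro i hi
    rw [Finset.mem_range] at hi
    rw [Finset.mem_Icc]
    omega
  · intro l hl
    rw [Finset.mem_Icc] at hl
    rw [Finset.mem_range]
    omega
  · intro i hi
    simp
  · intro l hl
    rw [Finset.mem_Icc] at hl
    omega
  · intro i hi
    rfl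

end ThetaDis

open ThetaDis

/-- the `k`-dissection of the modified Jacobi theta function. Here
`⌈(1-k)/2⌉ = -((k-1)/2)` and `⌈(k-1)/2⌉ = k/2` (natural division), and all powers of `q`
occurring are nonnegative integer powers. -/
theorem theta_dissection (k : ℕ) (hk : 0 < k) (z q : ℂ) (hz : z ≠ 0)
    (hq0 : 0 < ‖q‖) (hq1 : ‖q‖ < 1) :
    jacobiTheta' z q =
      (∏' n : ℕ, (1 - (q ^ (k ^ 2)) ^ (n + 1))) / (∏' n : ℕ, (1 - q ^ (n + 1))) *
        ∑ l ∈ Finset.Icc (-(((k - 1) / 2 : ℕ) : ℤ)) ((k / 2 : ℕ) : ℤ),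
          (-1 : ℂ) ^ l * q ^ ((l * (l - 1) / 2).toNat) * z ^ l *
            jacobiTheta'
              ((-1 : ℂ) ^ (k - 1) * z ^ (k : ℕ) *
                q ^ (((k : ℤ) * ((k : ℤ) - 1 + 2 * l) / 2).toNat))
              (q ^ (k ^ 2)) := by
  have hq : q ≠ 0 := norm_pos_iff.mp hq0
  have hne := Pinf_ne hq1
  have hQ : q ^ (k ^ 2) ≠ 0 := pow_ne_zero _ hq
  have hQ1 : ‖q ^ (k ^ 2)‖ < 1 := by
    rw [norm_pow]; exact pow_lt_one₀ (norm_nonneg _) hq1 (by positivity)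
  have key : ∑' n, a z q n = ∑ l ∈ Finset.Icc (-(((k - 1) / 2 : ℕ) : ℤ)) ((k / 2 : ℕ) : ℤ),
      ∑' m : ℤ, a z q (k * m + l) := by
    exact reindex hk (a z q) (summable_a hz hq hq1)
  rw [jtp hz hq hq1] at key
  change _ = Pinf (q ^ (k ^ 2)) / Pinf q * _
  rw [div_mul_eq_mul_div, eq_div_iff hne, mul_comm, key, Finset.mul_sum]
  refine Finset.sum_congr rfl fun l hl => ?_
  rw [Finset.mem_Icc] at hl
  have hF := two_F k l
  have hF0 : 0 ≤ (k : ℤ) * ((k : ℤ) - 1 + 2 * l) / 2 := by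
    apply Int.ediv_nonneg _ (by norm_num)
    apply mul_nonneg (by omega)
    omega
  set F : ℤ := (k : ℤ) * ((k : ℤ) - 1 + 2 * l) / 2 with hFdef
  have hqF : q ^ F.toNat = q ^ F := by
    rw [← zpow_natCast, Int.toNat_of_nonneg hF0]
  have hqE : q ^ ((l * (l - 1) / 2).toNat) = q ^ (E l) := by
    rw [← zpow_natCast]
    congr 1
    exact Int.toNat_of_nonneg (E_nonneg l)
  rw [hqF, hqE]
  have hw : (-1 : ℂ) ^ (k - 1) * z ^ k * q ^ F ≠ 0 :=
    mul_ne_zero (mul_ne_zero (pow_ne_zero _ (by norm_num)) (pow_ne_zero _ hz)) (zpow_ne_zero _ hq)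
  rw [tsum_congr fun m => a_split hk hz hq m l F hF, tsum_mul_left, jtp hw hQ hQ1]
  unfold a
  ring
end
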